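/- arXiv:1305.3001 — 13 statements merged into one kernel-verified Lean document; each statement's English description precedes it below -/
import Mathlib

section
/- Let B = (B_j)_{j∈J} be an additive system and let {J_i}_{i∈I} be a partition of J into pairwise disjoint nonempty sets. If A_i = Σ_{j∈J_i} B_j for each i ∈ I, then A = (A_i)_{i∈I} is an additive system. -/
/-- An additive system: a family of sets of nonnegative integers, indexed by a
nonempty set `I`, each containing `0` and having at least two elements, such that
every nonnegative integer has a unique representation as a finitely supported sum
`∑ i, a i` with `a i ∈ A i`. -/
def IsAdditiveSystem {I : Type*} (A : I → Set ℕ) : Prop :=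
  Nonempty I ∧ (∀ i, 0 ∈ A i) ∧ (∀ i, (A i).Nontrivial) ∧
    ∀ n : ℕ, ∃! f : I →₀ ℕ, (∀ i, f i ∈ A i) ∧ f.sum (fun _ x => x) = n
/-- The sumset `∑ j ∈ T, B j`: all finitely supported sums of elements `b j ∈ B j`
with `b j = 0` for `j ∉ T`. -/
def famSum {J : Type*} (B : J → Set ℕ) (T : Set J) : Set ℕ :=
  {n | ∃ f : J →₀ ℕ, (∀ j, f j ∈ B j) ∧ (∀ j, j ∉ T → f j = 0) ∧
    f.sum (fun _ x => x) = n}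
/-- `P` is a partition of the index type `J` into pairwise disjoint nonempty sets. -/
def IsPartitionFam {I J : Type*} (P : I → Set J) : Prop :=
  (∀ i, (P i).Nonempty) ∧ (Pairwise fun i i' => Disjoint (P i) (P i')) ∧
    (⋃ i, P i) = Set.univ

theorem IsPartitionFam.exists_eq_preimage {I J : Type*} {P : I → Set J}
    (hP : IsPartitionFam P) : ∃ p : J → I, ∀ i, P i = p ⁻¹' {i} := by
  obtain ⟨-, hdisj, hunion⟩ := hP
  have hcover : ∀ j, ∃ i, j ∈ P i := fun j =>
    Set.mem_iUnion.1 (hunion.symm ▸ Set.mem_univ j)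
  choose p hp using hcover
  refine ⟨p, fun i => Set.ext fun j => ⟨fun hj => ?_, ?_⟩⟩
  · by_contra hne
    exact Set.disjoint_left.1 (hdisj hne) (hp j) hj
  · rintro rfl
    exact hp j

theorem subset_famSum {J : Type*} {B : J → Set ℕ} (h0 : ∀ j, 0 ∈ B j) {T : Set J} {j : J}
    (hj : j ∈ T) : B j ⊆ famSum B T := by
  classical
  intro b hb
  refine ⟨Finsupp.single j b, fun k => ?_, fun k hk => ?_, by simp⟩
  · rcases eq_or_ne j k with rfl | hne
    · simpa using hb
    · simpa [Finsupp.single_apply, hne] using h0 k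
  · exact Finsupp.single_eq_of_ne (by rintro rfl; exact hk hj)

theorem Finsupp.sum_mapDomain_id {I J : Type*} (p : J → I) (f : J →₀ ℕ) :
    ((f.mapDomain p).sum fun _ x => x) = f.sum fun _ x => x :=
  Finsupp.sum_mapDomain_index (fun _ => rfl) (fun _ _ _ => rfl)

theorem mapDomain_apply_mem_famSum {I J : Type*} {B : J → Set ℕ} (h0 : ∀ j, 0 ∈ B j)
    (p : J → I) {f : J →₀ ℕ} (hf : ∀ j, f j ∈ B j) (i : I) :
    f.mapDomain p i ∈ famSum B (p ⁻¹' {i}) := by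
  classical
  refine ⟨f.filter (p · = i), fun j => ?_, fun j hj => ?_, ?_⟩
  · rw [Finsupp.filter_apply]
    split_ifs
    exacts [hf j, h0 j]
  · exact Finsupp.filter_apply_neg _ _ hj
  · rw [Finsupp.mapDomain, Finsupp.sum_apply, Finsupp.sum, Finsupp.sum, Finsupp.support_filter,
      Finset.sum_filter]
    refine Finset.sum_congr rfl fun j _ => ?_
    simp only [Finsupp.single_apply, Finsupp.filter_apply]
    split_ifs <;> rfl

theorem exists_mapDomain_eq_of_mem_famSum {I J : Type*} {B : J → Set ℕ} (p : J → I)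
    {h : I →₀ ℕ} (hh : ∀ i, h i ∈ famSum B (p ⁻¹' {i})) :
    ∃ f : J →₀ ℕ, (∀ j, f j ∈ B j) ∧ f.mapDomain p = h := by
  classical
  choose g hgB hgT hgsum using hh
  have hg0 : ∀ i, h i = 0 → g i = 0 := fun i hi => by
    have hsum := hgsum i
    rw [hi, Finsupp.sum, Finset.sum_eq_zero_iff] at hsum
    ext j
    by_contra hj
    exact hj (hsum j (Finsupp.mem_support_iff.2 hj))
  refine ⟨∑ i ∈ h.support, g i, fun j => ?_, ?_⟩
  · have hval : (∑ i ∈ h.support, g i) j = g (p j) j := by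
      rw [Finsupp.finsetSum_apply]
      refine Finset.sum_eq_single (p j) (fun i _ hi => hgT i j fun hj => hi hj.symm) fun hj => ?_
      rw [hg0 _ (Finsupp.notMem_support_iff.1 hj), Finsupp.zero_apply]
    rw [hval]
    exact hgB _ j
  · have hsingle : ∀ i, (g i).mapDomain p = Finsupp.single i (h i) := fun i => by
      rw [← hgsum i, Finsupp.mapDomain, Finsupp.sum, Finsupp.sum, Finsupp.single_finsetSum]
      refine Finset.sum_congr rfl fun j hj => ?_
      have hpj : p j = i := by
        by_contra hne
        exact Finsupp.mem_support_iff.1 hj (hgT i j hne)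
      rw [hpj]
    rw [Finsupp.mapDomain_finsetSum, Finset.sum_congr rfl fun i _ => hsingle i]
    exact Finsupp.sum_single h

/-- Lemma 1: a contraction of an additive system is an additive system. -/
theorem contraction_isAdditiveSystem {J I : Type*} (B : J → Set ℕ)
    (hB : IsAdditiveSystem B) (P : I → Set J) (hP : IsPartitionFam P)
    (A : I → Set ℕ) (hA : ∀ i, A i = famSum B (P i)) :
    IsAdditiveSystem A := by
  obtain ⟨⟨j₀⟩, h0, hnt, huniq⟩ := hB
  have hsub : ∀ i, ∃ j, B j ⊆ A i := fun i => by
    obtain ⟨j, hj⟩ := hP.1 i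
    exact ⟨j, hA i ▸ subset_famSum h0 hj⟩
  obtain ⟨p, hp⟩ := hP.exists_eq_preimage
  simp only [hp] at hA
  refine ⟨⟨p j₀⟩, fun i => ?_, fun i => ?_, fun n => ?_⟩
  · obtain ⟨j, hj⟩ := hsub i
    exact hj (h0 j)
  · obtain ⟨j, hj⟩ := hsub i
    exact (hnt j).mono hj
  · obtain ⟨f, ⟨hfB, hfn⟩, hf⟩ := huniq n
    refine ⟨f.mapDomain p, ⟨fun i => hA i ▸ mapDomain_apply_mem_famSum h0 p hfB i, ?_⟩, ?_⟩
    · rw [Finsupp.sum_mapDomain_id, hfn]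
    · rintro h ⟨hhA, hhn⟩
      obtain ⟨g, hgB, rfl⟩ := exists_mapDomain_eq_of_mem_famSum p fun i => hA i ▸ hhA i
      rw [hf g ⟨hgB, by rw [← hhn, Finsupp.sum_mapDomain_id]⟩]
end

section
/- Let B = (B_j)_{j∈J} be an additive system, let g ≥ 2 be an integer, and let I = {i_0} ∪ J where i_0 ∉ J. Define A_{i_0} = [0,g) and A_j = g∗B_j for all j ∈ J. Then A = (A_i)_{i∈I} is an additive system. -/
/-- Splitting off the `none` coordinate of a sum over `Option J`. -/
theorem Finsupp.sum_id_option {J : Type*} (f : Option J →₀ ℕ) :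
    f.sum (fun _ x => x) = f none + f.some.sum (fun _ x => x) :=
  Finsupp.sum_option_index f (fun _ x => x) (fun _ => rfl) (fun _ _ _ => rfl)

/-- The sum of a dilated finitely supported function. -/
theorem Finsupp.sum_id_smul {J : Type*} (g : ℕ) (h : J →₀ ℕ) :
    (g • h).sum (fun _ x => x) = g * h.sum (fun _ x => x) := by
  rw [Finsupp.sum_smul_index' (fun _ => rfl), Finsupp.mul_sum]
  rfl

/-- Lemma 2: the dilation of an additive system `B` by `g ≥ 2`, obtained by
adjoining the set `[0,g)` to the dilated family `(g ∗ B_j)`, is an additive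
system (indexed by `Option J`, with `none` playing the role of `i₀ ∉ J`). -/
theorem dilation_isAdditiveSystem {J : Type*} (B : J → Set ℕ)
    (hB : IsAdditiveSystem B) (g : ℕ) (hg : 2 ≤ g)
    (A : Option J → Set ℕ) (hA0 : A none = {x | x < g})
    (hAj : ∀ j : J, A (some j) = (fun x => g * x) '' B j) :
    IsAdditiveSystem A := by
  obtain ⟨-, h0, hnt, hrep⟩ := hB
  have hg0 : 0 < g := by omega
  have hinj : Function.Injective (fun x : ℕ => g * x) := fun _ _ h =>
    Nat.eq_of_mul_eq_mul_left hg0 h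
  refine ⟨⟨none⟩, ?_, ?_, fun n => ?_⟩
  · rintro (_ | j)
    · rw [hA0]
      exact hg0
    · rw [hAj]
      exact ⟨0, h0 j, Nat.mul_zero g⟩
  · rintro (_ | j)
    · rw [hA0]
      exact ⟨0, hg0, 1, hg, zero_ne_one⟩
    · rw [hAj]
      exact (hnt j).image hinj
  · obtain ⟨h, ⟨hmem, hsum⟩, huniq⟩ := hrep (n / g)
    refine ⟨(g • h).optionElim (n % g), ⟨?_, ?_⟩, ?_⟩
    · rintro (_ | j)
      · rw [hA0, Finsupp.optionElim_apply_none]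
        exact Nat.mod_lt n hg0
      · rw [hAj, Finsupp.optionElim_apply_some]
        exact ⟨h j, hmem j, rfl⟩
    · rw [Finsupp.sum_id_option, Finsupp.optionElim_apply_none, Finsupp.some_optionElim,
        Finsupp.sum_id_smul, hsum, Nat.mod_add_div]
    · rintro f ⟨hfmem, hfsum⟩
      have hlt : f none < g := by simpa [hA0] using hfmem none
      have hdil : ∀ j, ∃ b ∈ B j, g * b = f (some j) := fun j => by
        simpa [hAj] using hfmem (some j)
      obtain ⟨k, hk⟩ : ∃ k : J →₀ ℕ, f.some = g • k := by
        refine ⟨f.some.mapRange (· / g) (Nat.zero_div g), Finsupp.ext fun j => ?_⟩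
        obtain ⟨b, -, hb⟩ := hdil j
        simp [← hb, Nat.mul_div_cancel_left b hg0]
      have hkmem : ∀ j, k j ∈ B j := fun j => by
        obtain ⟨b, hbB, hb⟩ := hdil j
        have hkj : g * b = g * k j := hb.trans (DFunLike.congr_fun hk j)
        exact hinj hkj ▸ hbB
      rw [Finsupp.sum_id_option, hk, Finsupp.sum_id_smul] at hfsum
      have hdivmod := (Nat.div_mod_unique hg0).2 ⟨hfsum, hlt⟩
      rw [← huniq k ⟨hkmem, hdivmod.1.symm⟩, hdivmod.2, ← hk, Finsupp.optionElim_some]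
end

section
/- Every additive system is a contraction of a British number system; that is, for every additive system A = (A_i)_{i∈I} there exist a sequence (g_j)_{j∈ℕ} of integers with g_j ≥ 2 for all j, and a partition {J_i}_{i∈I} of ℕ into pairwise disjoint nonempty sets, such that A_i = Σ_{j∈J_i} G_{j-1}∗[0,g_j) for every i ∈ I, where G_0 = 1 and G_j = g_1⋯g_j. -/
/-- The `i`-th set of the British number system generated by `g` (indexed from `0`):
`G_{i-1} ∗ [0, g_i)` where `G_{i-1} = g_0 ⋯ g_{i-1}`. -/
def BNS (g : ℕ → ℕ) (i : ℕ) : Set ℕ :=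
  (fun x => (∏ j ∈ Finset.range i, g j) * x) '' {x | x < g i}

/-- A family of sets containing `0`, some of which may be `{0}`, such that every natural number is
uniquely a finitely supported sum of members. -/
def IsWeakAdditiveSystem {I : Type*} (A : I → Set ℕ) : Prop :=
  (∀ i, 0 ∈ A i) ∧ ∀ n : ℕ, ∃! f : I →₀ ℕ, (∀ i, f i ∈ A i) ∧ f.sum (fun _ x => x) = n

/-- If `X ⊕ Y = ℕ` and `g` is the least number missing from `X`, then `Y` consists of multiples of
`g` and `X` is a union of blocks `[k * g, (k + 1) * g)`. -/
theorem block_structure_of_direct_sum {X Y : Set ℕ} (hX : 0 ∈ X) (hY : 0 ∈ Y)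
    (hex : ∀ n, ∃ x ∈ X, ∃ y ∈ Y, x + y = n)
    (huniq : ∀ x ∈ X, ∀ y ∈ Y, ∀ x' ∈ X, ∀ y' ∈ Y, x + y = x' + y' → y = y')
    {g : ℕ} (hlt : ∀ r < g, r ∈ X) (hg : g ∉ X) (k : ℕ) :
    ∀ r < g, (k * g + r ∈ Y → r = 0) ∧ (k * g + r ∈ X ↔ k * g ∈ X) := by
  have hXY : ∀ z, z ∈ X → z ∈ Y → z = 0 := fun z hx hy =>
    huniq 0 hX z hy z hx 0 hY (by omega)
  have hgY : g ∈ Y := by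
    obtain ⟨x, hx, y, hy, h⟩ := hex g
    rcases Nat.eq_zero_or_pos y with rfl | hy0
    · exact absurd (by simpa [← h] using hx) hg
    · rcases lt_or_ge y g with hyg | hyg
      · have := hXY y (hlt y hyg) hy
        omega
      · obtain rfl : y = g := by omega
        exact hy
  induction k using Nat.strong_induction_on with
  | _ k ih =>
  intro r hr
  rcases Nat.eq_zero_or_pos k with rfl | hk
  · simp only [zero_mul, zero_add]
    exact ⟨hXY r (hlt r hr), iff_of_true (hlt r hr) hX⟩
  have hg0 : 0 < g := by omega
  have hlow : ∀ y ∈ Y, y < k * g → ∃ m < k, y = m * g := by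
    intro y hy hyk
    have hm : y / g < k := (Nat.div_lt_iff_lt_mul hg0).2 hyk
    have hdm := Nat.div_add_mod' y g
    have := (ih (y / g) hm (y % g) (Nat.mod_lt _ hg0)).1 (by rwa [hdm])
    exact ⟨y / g, hm, by omega⟩
  have hcomp : ∀ m < k, m * g + (k - m) * g = k * g := by
    intro m hm
    rw [← add_mul]
    congr 1
    omega
  have hkg : g ≤ k * g := Nat.le_mul_of_pos_left g hk
  obtain ⟨x, hx, y, hy, h⟩ := hex (k * g)
  rcases Nat.eq_zero_or_pos y with rfl | hy0
  · have hkX : k * g ∈ X := by simpa [← h] using hx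
    have hnotY : ∀ s < g, k * g + s ∉ Y := by
      intro s hs hsY
      rcases Nat.eq_zero_or_pos s with rfl | hs0
      · have := hXY (k * g) hkX hsY
        omega
      · have := huniq (g - s) (hlt _ (by omega)) _ hsY (k * g) hkX g hgY (by omega)
        omega
    refine ⟨fun h' => absurd h' (hnotY r hr), iff_of_true ?_ hkX⟩
    obtain ⟨u, hu, v, hv, huv⟩ := hex (k * g + r)
    have hvk : v < k * g := by
      by_contra hvk
      refine hnotY (v - k * g) (by omega) ?_
      rwa [Nat.add_sub_cancel' (by omega)]
    obtain ⟨m, hm, rfl⟩ := hlow v hv hvk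
    have hc := hcomp m hm
    rcases Nat.eq_zero_or_pos m with rfl | hm0
    · simpa [← huv] using hu
    · have hu' : (k - m) * g ∈ X := by
        refine ((ih (k - m) (by omega) r hr).2).1 ?_
        rwa [show (k - m) * g + r = u by omega]
      have := huniq _ hu' _ hv _ hkX 0 hY (by omega)
      have : 0 < m * g := Nat.mul_pos hm0 hg0
      omega
  · rcases lt_or_ge y (k * g) with hyk | hyk
    · obtain ⟨m, hm, rfl⟩ := hlow y hy hyk
      have hc := hcomp m hm
      have hm0 : 0 < m := Nat.pos_of_mul_pos_right hy0
      obtain rfl : x = (k - m) * g := by omega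
      have hblock : ∀ s < g, (k - m) * g + s ∈ X := fun s hs =>
        (ih (k - m) (by omega) s hs).2.2 hx
      have hnotX : ∀ s < g, k * g + s ∉ X := by
        intro s hs hsX
        have := huniq _ (hblock s hs) _ hy _ hsX 0 hY (by omega)
        omega
      refine ⟨fun h' => ?_, iff_of_false (hnotX r hr) (by simpa using hnotX 0 hg0)⟩
      have := huniq _ (hblock r hr) _ hy 0 hX _ h' (by omega)
      omega
    · obtain rfl : y = k * g := by omega
      have hkX : k * g ∉ X := fun h' => by
        have := hXY _ h' hy
        omega
      refine ⟨fun h' => ?_, iff_of_false (fun h' => ?_) hkX⟩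
      · have := huniq r (hlt r hr) _ hy 0 hX _ h' (by omega)
        omega
      · have := huniq r (hlt r hr) _ hy _ h' 0 hY (by omega)
        omega

/-- The member `A i` and the sums of the other members form a direct sum decomposition of `ℕ`. -/
theorem IsWeakAdditiveSystem.direct_sum {I : Type*} {A : I → Set ℕ}
    (hA : IsWeakAdditiveSystem A) (i : I) :
    (∀ n, ∃ x ∈ A i, ∃ y ∈ famSum A {i}ᶜ, x + y = n) ∧
      ∀ x ∈ A i, ∀ y ∈ famSum A {i}ᶜ, ∀ x' ∈ A i, ∀ y' ∈ famSum A {i}ᶜ,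
        x + y = x' + y' → y = y' := by
  classical
  refine ⟨fun n => ?_, ?_⟩
  · obtain ⟨f, ⟨hf, hsum⟩, -⟩ := hA.2 n
    refine ⟨f i, hf i, (f.erase i).sum (fun _ x => x), ⟨f.erase i, fun j => ?_, ?_, rfl⟩, ?_⟩
    · rcases eq_or_ne j i with rfl | hj
      · simpa using hA.1 j
      · simpa [Finsupp.erase_ne hj] using hf j
    · simp
    · rw [← hsum]
      exact Finsupp.add_sum_erase' f i (fun _ x => x) (fun _ => rfl)
  · have key : ∀ f : I →₀ ℕ, (∀ j, f j ∈ A j) → (∀ j, j ∉ ({i}ᶜ : Set I) → f j = 0) →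
        ∀ x ∈ A i, (∀ j, (f + Finsupp.single i x) j ∈ A j) ∧
          (f + Finsupp.single i x).sum (fun _ x => x) = x + f.sum (fun _ x => x) := by
      intro f hf hfi x hx
      refine ⟨fun j => ?_, ?_⟩
      · rcases eq_or_ne j i with rfl | hj
        · simpa [hfi j (by simp)] using hx
        · simpa [Finsupp.single_eq_of_ne hj] using hf j
      · rw [Finsupp.sum_add_index' (fun _ => rfl) (fun _ _ _ => rfl),
          Finsupp.sum_single_index rfl, add_comm]
    rintro x hx _ ⟨f, hf, hfi, rfl⟩ x' hx' _ ⟨f', hf', hfi', rfl⟩ h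
    obtain ⟨h1, h2⟩ := key f hf hfi x hx
    obtain ⟨h3, h4⟩ := key f' hf' hfi' x' hx'
    have heq := (hA.2 _).unique ⟨h1, h2⟩ ⟨h3, h4.trans h.symm⟩
    have hff : x = x' := by
      have := DFunLike.congr_fun heq i
      simpa [hfi i (by simp), hfi' i (by simp)] using this
    omega

theorem mem_famSum_of_mem {J : Type*} {B : J → Set ℕ} (hB : ∀ j, 0 ∈ B j) {T : Set J} {j : J}
    (hj : j ∈ T) {b : ℕ} (hb : b ∈ B j) : b ∈ famSum B T := by
  classical
  refine ⟨Finsupp.single j b, fun k => ?_, fun k hk => ?_, Finsupp.sum_single_index rfl⟩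
  · rcases eq_or_ne k j with rfl | hkj
    · simpa using hb
    · simpa [Finsupp.single_eq_of_ne hkj] using hB k
  · exact Finsupp.single_eq_of_ne (by rintro rfl; exact hk hj)

/-- Dividing a weak additive system by a common factor `g`. -/
theorem IsWeakAdditiveSystem.div {I : Type*} {A : I → Set ℕ} (hA : IsWeakAdditiveSystem A)
    {i : I} {g : ℕ} (hg : 0 < g) (hdvd : ∀ j, j ≠ i → ∀ a ∈ A j, g ∣ a) :
    IsWeakAdditiveSystem fun j => {q | g * q ∈ A j} := by
  classical
  have hsum_mul : ∀ f : I →₀ ℕ,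
      (f.mapRange (g * ·) (mul_zero g)).sum (fun _ x => x) = g * f.sum (fun _ x => x) := by
    intro f
    rw [Finsupp.sum_mapRange_index (fun _ => rfl), Finsupp.mul_sum]
  refine ⟨fun j => by simpa using hA.1 j, fun n => ?_⟩
  obtain ⟨f, ⟨hf, hsum⟩, huniq⟩ := hA.2 (g * n)
  have hfdvd : ∀ j, g ∣ f j := by
    intro j
    rcases eq_or_ne j i with rfl | hj
    · have h1 : f j + (f.erase j).sum (fun _ x => x) = f.sum (fun _ x => x) :=
        Finsupp.add_sum_erase' f j (fun _ x => x) (fun _ => rfl)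
      have h2 : g ∣ (f.erase j).sum (fun _ x => x) := by
        refine Finset.dvd_sum fun k hk => ?_
        have hkj : k ≠ j := by
          rintro rfl
          simp at hk
        rw [Finsupp.erase_ne hkj]
        exact hdvd k hkj _ (hf k)
      refine (Nat.dvd_add_left h2).1 ?_
      rw [h1, hsum]
      exact dvd_mul_right g n
    · exact hdvd j hj _ (hf j)
  have hmul : (f.mapRange (· / g) (Nat.zero_div g)).mapRange (g * ·) (mul_zero g) = f := by
    ext j
    simpa using Nat.mul_div_cancel' (hfdvd j)
  refine ⟨f.mapRange (· / g) (Nat.zero_div g), ⟨fun j => ?_, ?_⟩, ?_⟩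
  · simpa [Nat.mul_div_cancel' (hfdvd j)] using hf j
  · apply Nat.eq_of_mul_eq_mul_left hg
    rw [← hsum_mul, hmul, hsum]
  · rintro f' ⟨hf', hsum'⟩
    have := huniq (f'.mapRange (g * ·) (mul_zero g))
      ⟨fun j => by simpa using hf' j, by rw [hsum_mul, hsum']⟩
    rw [← hmul] at this
    exact Finsupp.mapRange_injective _ (mul_zero g)
      (fun a b h => Nat.eq_of_mul_eq_mul_left hg h) this.symm |>.symm

/-- One digit `[0, g)` can be split off from a weak additive system. -/
theorem IsWeakAdditiveSystem.exists_split {I : Type*} {A : I → Set ℕ}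
    (hA : IsWeakAdditiveSystem A) :
    ∃ (i : I) (g : ℕ) (B : I → Set ℕ), 2 ≤ g ∧ IsWeakAdditiveSystem B ∧
      (∀ a, a ∈ A i ↔ ∃ r < g, ∃ q ∈ B i, a = r + g * q) ∧
      ∀ j, j ≠ i → ∀ a, a ∈ A j ↔ ∃ q ∈ B j, a = g * q := by
  obtain ⟨i, hi⟩ : ∃ i, 1 ∈ A i := by
    obtain ⟨f, ⟨hf, hsum⟩, -⟩ := hA.2 1
    obtain ⟨i, hi⟩ : ∃ i, f i ≠ 0 := by
      by_contra! h
      obtain rfl : f = 0 := Finsupp.ext h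
      simp at hsum
    have hle : f i ≤ 1 := by
      rw [← hsum]
      exact Finset.single_le_sum (f := fun j => f j) (fun _ _ => Nat.zero_le _)
        (Finsupp.mem_support_iff.2 hi)
    exact ⟨i, by simpa [show f i = 1 by omega] using hf i⟩
  have h0Y : 0 ∈ famSum A {i}ᶜ := ⟨0, by simpa using hA.1, by simp, by simp⟩
  obtain ⟨hex, huniq⟩ := hA.direct_sum i
  have hmem : ∀ j, j ≠ i → ∀ a ∈ A j, a ∈ famSum A {i}ᶜ := fun j hj a ha =>
    mem_famSum_of_mem hA.1 (by simpa using hj) ha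
  obtain ⟨g, hg2, hdvd, hblock⟩ : ∃ g, 2 ≤ g ∧ (∀ j, j ≠ i → ∀ a ∈ A j, g ∣ a) ∧
      ∀ k, ∀ r < g, (k * g + r ∈ A i ↔ k * g ∈ A i) := by
    classical
    by_cases hall : ∀ n, n ∈ A i
    · refine ⟨2, le_rfl, fun j hj a ha => ?_, by simp [hall]⟩
      have := huniq 0 (hall 0) a (hmem j hj a ha) a (hall a) 0 h0Y (by omega)
      simp [this]
    · push Not at hall
      have hmin : ∀ r < Nat.find hall, r ∈ A i := fun r hr => by
        simpa using Nat.find_min hall hr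
      have hnot := Nat.find_spec hall
      have hstr := block_structure_of_direct_sum (hA.1 i) h0Y hex huniq hmin hnot
      have hg2 : 2 ≤ Nat.find hall := by
        by_contra hlt
        obtain h | h : Nat.find hall = 0 ∨ Nat.find hall = 1 := by omega
        · exact hnot (h ▸ hA.1 i)
        · exact hnot (h ▸ hi)
      refine ⟨Nat.find hall, hg2, fun j hj a ha => ?_, fun k r hr => (hstr k r hr).2⟩
      refine Nat.dvd_of_mod_eq_zero ((hstr (a / Nat.find hall) _ (Nat.mod_lt _ (by omega))).1 ?_)
      rw [Nat.div_add_mod']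
      exact hmem j hj a ha
  have hg0 : 0 < g := by omega
  refine ⟨i, g, fun j => {q | g * q ∈ A j}, hg2, hA.div hg0 hdvd, fun a => ⟨fun ha => ?_, ?_⟩,
    fun j hj a => ⟨fun ha => ?_, ?_⟩⟩
  · refine ⟨a % g, Nat.mod_lt _ hg0, a / g, ?_, (Nat.mod_add_div a g).symm⟩
    rw [Set.mem_ofPred_eq, mul_comm, ← hblock _ _ (Nat.mod_lt a hg0), Nat.div_add_mod']
    exact ha
  · rintro ⟨r, hr, q, hq, rfl⟩
    rw [add_comm, mul_comm, hblock q r hr, mul_comm]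
    exact hq
  · obtain ⟨q, rfl⟩ := hdvd j hj a ha
    exact ⟨q, ha, rfl⟩
  · rintro ⟨q, hq, rfl⟩
    exact hq

theorem zero_mem_BNS {g : ℕ → ℕ} (hg : ∀ j, 2 ≤ g j) (j : ℕ) : 0 ∈ BNS g j :=
  ⟨0, by have := hg j; simp only [Set.mem_ofPred_eq]; omega, by simp⟩

/-- Expansion of the elements of `A i` to `n` digits, when `C n` is obtained from `A` by splitting
off `n` digits, the `k`-th one from the member with index `idx k`. -/
theorem mem_iff_exists_digits {I : Type*} {C : ℕ → I → Set ℕ} {idx : ℕ → I} {g : ℕ → ℕ}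
    (hg : ∀ n, 2 ≤ g n)
    (hself : ∀ n a, a ∈ C n (idx n) ↔ ∃ r < g n, ∃ q ∈ C (n + 1) (idx n), a = r + g n * q)
    (hne : ∀ n j, j ≠ idx n → ∀ a, a ∈ C n j ↔ ∃ q ∈ C (n + 1) j, a = g n * q)
    (i : I) (n a : ℕ) :
    a ∈ C 0 i ↔ ∃ f : ℕ → ℕ, (∀ j, f j ∈ BNS g j) ∧ (∀ j, idx j ≠ i → f j = 0) ∧
      (∀ j, n ≤ j → f j = 0) ∧ ∃ c ∈ C n i,
        a = ∑ j ∈ Finset.range n, f j + (∏ j ∈ Finset.range n, g j) * c := by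
  induction n with
  | zero =>
    constructor
    · intro ha
      exact ⟨0, zero_mem_BNS hg, by simp, by simp, a, ha, by simp⟩
    · rintro ⟨f, -, -, -, c, hc, rfl⟩
      simpa using hc
  | succ n ih =>
    rw [ih]
    constructor
    · rintro ⟨f, hf, hfi, hfn, c, hc, rfl⟩
      by_cases hi : i = idx n
      · subst hi
        obtain ⟨r, hr, q, hq, rfl⟩ := (hself n c).1 hc
        refine ⟨Function.update f n ((∏ j ∈ Finset.range n, g j) * r), fun j => ?_, fun j hj => ?_,
          fun j hj => ?_, q, hq, ?_⟩
        · rcases eq_or_ne j n with rfl | hjn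
          · simpa using ⟨r, hr, rfl⟩
          · simpa [hjn] using hf j
        · rw [Function.update_of_ne (by rintro rfl; exact hj rfl)]
          exact hfi j hj
        · rw [Function.update_of_ne (by omega)]
          exact hfn j (by omega)
        · rw [Finset.sum_range_succ, Finset.prod_range_succ, Function.update_self,
            Finset.sum_update_of_notMem (by simp)]
          ring
      · obtain ⟨q, hq, rfl⟩ := (hne n i hi c).1 hc
        refine ⟨f, hf, hfi, fun j hj => hfn j (by omega), q, hq, ?_⟩
        rw [Finset.sum_range_succ, Finset.prod_range_succ, hfn n le_rfl]
        ring
    · rintro ⟨f, hf, hfi, hfn, q, hq, rfl⟩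
      obtain ⟨r, hr, hfr⟩ := hf n
      refine ⟨Function.update f n 0, fun j => ?_, fun j hj => ?_, fun j hj => ?_,
        r + g n * q, ?_, ?_⟩
      · rcases eq_or_ne j n with rfl | hjn
        · simpa using zero_mem_BNS hg j
        · simpa [hjn] using hf j
      · rcases eq_or_ne j n with rfl | hjn
        · simp
        · simpa [hjn] using hfi j hj
      · rcases eq_or_ne j n with rfl | hjn
        · simp
        · simpa [hjn] using hfn j (by omega)
      · by_cases hi : i = idx n
        · subst hi
          exact (hself n _).2 ⟨r, hr, q, hq, rfl⟩
        · refine (hne n i hi _).2 ⟨q, hq, ?_⟩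
          have hzero : (∏ j ∈ Finset.range n, g j) * r = 0 := hfr.trans (hfi n (Ne.symm hi))
          have hpos : 0 < ∏ j ∈ Finset.range n, g j :=
            Finset.prod_pos fun j _ => by have := hg j; omega
          have hr0 : r = 0 := (Nat.mul_eq_zero.1 hzero).resolve_left hpos.ne'
          simp [hr0]
      · rw [Finset.sum_range_succ, Finset.prod_range_succ,
          Finset.sum_update_of_notMem (by simp), ← hfr]
        ring

theorem lt_prod_range {g : ℕ → ℕ} (hg : ∀ j, 2 ≤ g j) (n : ℕ) :
    n < ∏ j ∈ Finset.range n, g j :=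
  n.lt_two_pow_self.trans_le <| by
    simpa using Finset.pow_card_le_prod (s := Finset.range n) (f := g) (n := 2) fun j _ => hg j

/-- Iterated splitting of digits exhibits the initial family as a contraction. -/
theorem eq_famSum_of_split {I : Type*} {C : ℕ → I → Set ℕ} {idx : ℕ → I} {g : ℕ → ℕ}
    (hg : ∀ n, 2 ≤ g n) (h0 : ∀ n i, 0 ∈ C n i)
    (hself : ∀ n a, a ∈ C n (idx n) ↔ ∃ r < g n, ∃ q ∈ C (n + 1) (idx n), a = r + g n * q)
    (hne : ∀ n j, j ≠ idx n → ∀ a, a ∈ C n j ↔ ∃ q ∈ C (n + 1) j, a = g n * q) (i : I) :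
    C 0 i = famSum (BNS g) {j | idx j = i} := by
  ext a
  constructor
  · intro ha
    obtain ⟨f, hf, hfi, hfn, c, -, hac⟩ := (mem_iff_exists_digits hg hself hne i a a).1 ha
    obtain rfl : c = 0 := by
      by_contra hc
      have := lt_prod_range hg a
      have := Nat.le_mul_of_pos_right (∏ j ∈ Finset.range a, g j) (Nat.pos_of_ne_zero hc)
      omega
    have hsupp : ∀ j, f j ≠ 0 → j ∈ Finset.range a := fun j hj => by
      rw [Finset.mem_range]
      by_contra h
      exact hj (hfn j (by omega))
    refine ⟨Finsupp.onFinset (Finset.range a) f hsupp, hf, hfi, ?_⟩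
    rw [Finsupp.onFinset_sum hsupp (fun _ => rfl)]
    simpa using hac.symm
  · rintro ⟨f, hf, hfi, rfl⟩
    have hlt : ∀ j, f j ≠ 0 → j < f.support.sup id + 1 := fun j hj =>
      Nat.lt_succ_of_le (Finset.le_sup (f := id) (Finsupp.mem_support_iff.2 hj))
    refine (mem_iff_exists_digits hg hself hne i (f.support.sup id + 1) _).2
      ⟨f, hf, hfi, fun j hj => ?_, 0, h0 _ i, ?_⟩
    · by_contra h
      have := hlt j h
      omega
    · rw [mul_zero, add_zero]
      exact Finsupp.sum_of_support_subset f
        (fun j hj => Finset.mem_range.2 (hlt j (Finsupp.mem_support_iff.1 hj))) _ (fun _ _ => rfl)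

/-- Theorem 2 (de Bruijn): every additive system is a contraction of a British
number system: there are a sequence `(g_j)` with `g_j ≥ 2` and a partition
`(P i)_{i ∈ I}` of `ℕ` into pairwise disjoint nonempty sets such that
`A i = ∑_{j ∈ P i} G_{j-1} ∗ [0, g_j)` for every `i`. -/
theorem every_additiveSystem_contraction_of_bns {I : Type*} (A : I → Set ℕ)
    (hA : IsAdditiveSystem A) :
    ∃ g : ℕ → ℕ, (∀ j, 2 ≤ g j) ∧
      ∃ P : I → Set ℕ, IsPartitionFam P ∧ ∀ i, A i = famSum (BNS g) (P i) := by
  obtain ⟨-, hA0, hAnt, hAsum⟩ := hA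
  choose idx g next hg hnext hself hne using
    fun B : {B : I → Set ℕ // IsWeakAdditiveSystem B} => B.2.exists_split
  let C : ℕ → {B : I → Set ℕ // IsWeakAdditiveSystem B} :=
    fun n => n.rec ⟨A, hA0, hAsum⟩ fun _ B => ⟨next B, hnext B⟩
  have hfam : ∀ i, A i = famSum (BNS fun n => g (C n)) {j | idx (C j) = i} :=
    eq_famSum_of_split (C := fun n => (C n).1) (idx := fun n => idx (C n))
      (fun n => hg (C n)) (fun n => (C n).2.1) (fun n => hself (C n)) (fun n => hne (C n))
  refine ⟨fun n => g (C n), fun n => hg (C n), fun i => {j | idx (C j) = i},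
    ⟨fun i => ?_, fun i i' hii' => ?_, ?_⟩, hfam⟩
  · obtain ⟨a, ha, ha0⟩ := (hAnt i).exists_ne 0
    rw [hfam i] at ha
    obtain ⟨f, -, hfi, rfl⟩ := ha
    by_contra hempty
    rw [Set.not_nonempty_iff_eq_empty] at hempty
    obtain rfl : f = 0 := Finsupp.ext fun j => hfi j (by simp [hempty])
    simp at ha0
  · refine Set.disjoint_left.2 ?_
    rintro j rfl h
    exact hii' h
  · exact Set.eq_univ_of_forall fun j => Set.mem_iUnion.2 ⟨idx (C j), rfl⟩
end

section
/- Let A = (A_i)_{i∈I} be an additive system with |I| ≥ 2. Then there exist an index i_1 ∈ I, an integer g ≥ 2, and a family of sets (B_i)_{i∈I} of nonnegative integers with 0 ∈ B_i for all i, such that A_{i_1} = [0,g) ⊕ g∗B_{i_1} (every element of A_{i_1} is uniquely a sum of an element of [0,g) and an element of g∗B_{i_1}), and A_i = g∗B_i for all i ∈ I \ {i_1}. Moreover, if B_{i_1} = {0}, then (B_i)_{i∈I\{i_1}} is an additive system, and if B_{i_1} ≠ {0}, then (B_i)_{i∈I} is an additive system. -/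
/-- If `A ⊕ C = ℕ`, `[0,g) ⊆ A` and `g ∈ C`, then within each block `[kg, kg + g)` the set `C`
contains at most the left end point, and `A` contains all of the block or nothing of it. -/
theorem tiling_block {A C : Set ℕ} {g : ℕ} (hA : ∀ u < g, u ∈ A) (h0C : 0 ∈ C) (hgC : g ∈ C)
    (hex : ∀ n, ∃ a ∈ A, ∃ c ∈ C, a + c = n)
    (huniq : ∀ a ∈ A, ∀ c ∈ C, ∀ a' ∈ A, ∀ c' ∈ C, a + c = a' + c' → c = c')
    (hg : 0 < g) (k : ℕ) :
    (∀ u < g, g * k + u ∈ C → u = 0) ∧ (∀ u < g, (g * k + u ∈ A ↔ g * k ∈ A)) := by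
  have h0A : 0 ∈ A := hA 0 hg
  induction k using Nat.strong_induction_on with
  | _ k ih =>
  rcases Nat.eq_zero_or_pos k with rfl | hk
  · refine ⟨fun u hu huC => ?_, fun u hu => by simp [hA u hu, h0A]⟩
    have := huniq u (hA u hu) 0 h0C 0 h0A _ huC (by omega)
    omega
  have hgk : g ≤ g * k := Nat.le_mul_of_pos_right g hk
  have early {a c u : ℕ} (hu : u < g) (ha : a ∈ A) (hc : c ∈ C) (hs : a + c = g * k + u)
      (hak : a < g * k) (hck : c < g * k) :
      ∃ b d, b < k ∧ d < k ∧ b + d = k ∧ c = g * d ∧ a = g * b + u ∧ g * b ∈ A := by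
    have hbk : a / g < k := Nat.div_lt_of_lt_mul hak
    have hdk : c / g < k := Nat.div_lt_of_lt_mul hck
    have ea := Nat.div_add_mod a g
    have ec := Nat.div_add_mod c g
    have ra := Nat.mod_lt a hg
    have hcz := (ih _ hdk).1 _ (Nat.mod_lt c hg) (by rwa [ec])
    have hba := ((ih _ hbk).2 _ ra).1 (by rwa [ea])
    have hmu : a % g = u := by
      have := congrArg (· % g) hs
      simp only [Nat.add_mod, hcz, Nat.mul_mod_right, Nat.zero_add, Nat.add_zero,
        Nat.mod_mod, Nat.mod_eq_of_lt hu] at this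
      exact this
    refine ⟨a / g, c / g, hbk, hdk, ?_, by omega, by omega, hba⟩
    apply Nat.eq_of_mul_eq_mul_left hg
    rw [Nat.mul_add]
    omega
  by_cases hkC : g * k ∈ C
  · have notA (u : ℕ) (hu : u < g) : g * k + u ∉ A := fun h => by
      have := huniq _ h 0 h0C u (hA u hu) _ hkC (by omega)
      omega
    refine ⟨fun u hu huC => ?_, fun u hu => iff_of_false (notA u hu) (notA 0 hg)⟩
    have := huniq 0 h0A _ huC u (hA u hu) _ hkC (by omega)
    omega
  by_cases hkA : g * k ∈ A
  · have notC (u : ℕ) (hu : u < g) : g * k + u ∉ C := fun h => by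
      rcases Nat.eq_zero_or_pos u with rfl | hu0
      · exact hkC h
      have := huniq _ hkA g hgC (g - u) (hA _ (by omega)) _ h (by omega)
      omega
    refine ⟨fun u hu h => (notC u hu h).elim, fun u hu => iff_of_true ?_ hkA⟩
    obtain ⟨a, ha, c, hc, hs⟩ := hex (g * k + u)
    have hck : c < g * k := by
      by_contra hck
      refine notC (c - g * k) (by omega) ?_
      rwa [Nat.add_sub_cancel' (by omega)]
    by_cases hak : a < g * k
    · obtain ⟨b, d, hb, hd, hbd, rfl, rfl, hbA⟩ := early hu ha hc hs hak hck
      have := huniq _ hbA _ hc _ hkA 0 h0C (by rw [← Nat.mul_add, hbd, Nat.add_zero])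
      omega
    · have := huniq 0 h0A c hc c (hA c (by omega)) 0 h0C (by omega)
      rwa [← hs, this, Nat.add_zero]
  · obtain ⟨a, ha, c, hc, hs⟩ := hex (g * k)
    have hak : a ≠ g * k := fun h => hkA (h ▸ ha)
    have hck : c ≠ g * k := fun h => hkC (h ▸ hc)
    obtain ⟨b, d, hb, hd, hbd, rfl, rfl, hbA⟩ :=
      early hg ha hc (by omega) (by omega) (by omega)
    have hb0 : 0 < g * b := Nat.mul_pos hg (by omega)
    have hd0 : 0 < g * d := Nat.mul_pos hg (by omega)
    have hbd' : g * b + g * d = g * k := by rw [← Nat.mul_add, hbd]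
    have hfull (u : ℕ) (hu : u < g) : g * b + u ∈ A := ((ih b hb).2 u hu).2 hbA
    have notA (u : ℕ) (hu : u < g) : g * k + u ∉ A := fun h => by
      have := huniq _ h 0 h0C _ (hfull u hu) _ hc (by omega)
      omega
    refine ⟨fun u hu huC => ?_, fun u hu => iff_of_false (notA u hu) (notA 0 hg)⟩
    have := huniq 0 h0A _ huC _ (hfull u hu) _ hc (by omega)
    omega

/-- If `A ⊕ C = ℕ` with `1 ∈ A` and `C ≠ {0}`, then for some `g ≥ 2` every element of `C` is a
multiple of `g` and `A` is a union of blocks `[gk, gk + g)`, including the block `[0,g)`. -/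
theorem exists_block_length {A C : Set ℕ} (h0A : 0 ∈ A) (h1A : 1 ∈ A) (h0C : 0 ∈ C)
    (hC : ∃ c ∈ C, c ≠ 0)
    (hex : ∀ n, ∃ a ∈ A, ∃ c ∈ C, a + c = n)
    (huniq : ∀ a ∈ A, ∀ c ∈ C, ∀ a' ∈ A, ∀ c' ∈ C, a + c = a' + c' → c = c') :
    ∃ g, 2 ≤ g ∧ (∀ c ∈ C, g ∣ c) ∧ ∀ k, ∀ u < g, (g * k + u ∈ A ↔ g * k ∈ A) := by
  classical
  have hne : ∃ n, n ∉ A := by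
    obtain ⟨c, hc, hc0⟩ := hC
    exact ⟨c, fun h => hc0 (huniq 0 h0A c hc c h 0 h0C (by omega))⟩
  have hgA := Nat.find_spec hne
  have hmin (u : ℕ) (hu : u < Nat.find hne) : u ∈ A := not_not.1 (Nat.find_min hne hu)
  generalize Nat.find hne = g at hgA hmin
  have hg0 : g ≠ 0 := fun h => hgA (h ▸ h0A)
  have hg1 : g ≠ 1 := fun h => hgA (h ▸ h1A)
  have hgC : g ∈ C := by
    obtain ⟨a, ha, c, hc, hs⟩ := hex g
    by_cases hcg : c < g
    · have := huniq 0 h0A c hc c (hmin c hcg) 0 h0C (by omega)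
      exact (hgA (by rwa [← hs, this, Nat.add_zero])).elim
    · rwa [show g = c by omega]
  have key := tiling_block hmin h0C hgC hex huniq (by omega)
  refine ⟨g, by omega, fun c hc => ?_, fun k => (key k).2⟩
  exact Nat.dvd_of_mod_eq_zero
    ((key (c / g)).1 _ (Nat.mod_lt c (by omega)) (by rwa [Nat.div_add_mod]))

theorem Finsupp.sum_id_eq_add_erase {I : Type*} (f : I →₀ ℕ) (i : I) :
    f.sum (fun _ x => x) = f i + (f.erase i).sum (fun _ x => x) :=
  (Finsupp.add_sum_erase' f i (fun _ x => x) (fun _ => rfl)).symm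

/-- The sums of elements of the sets `A i`, `i ≠ i₁`. -/
def complementSums {I : Type*} (A : I → Set ℕ) (i₁ : I) : Set ℕ :=
  {n | ∃ f : I →₀ ℕ, (∀ i, f i ∈ A i) ∧ f i₁ = 0 ∧ f.sum (fun _ x => x) = n}

section

variable {I : Type*} {A : I → Set ℕ} {i₁ : I}

theorem mem_complementSums_of_mem (h0 : ∀ i, 0 ∈ A i) {i : I} (hi : i ≠ i₁) {n : ℕ}
    (hn : n ∈ A i) : n ∈ complementSums A i₁ := by
  classical
  refine ⟨Finsupp.single i n, fun j => ?_, Finsupp.single_eq_of_ne hi.symm, by simp⟩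
  by_cases hj : j = i
  · subst hj
    simpa using hn
  · rw [Finsupp.single_eq_of_ne hj]
    exact h0 j

theorem erase_sum_mem_complementSums (h0 : ∀ i, 0 ∈ A i) {f : I →₀ ℕ} (hf : ∀ i, f i ∈ A i) :
    (f.erase i₁).sum (fun _ x => x) ∈ complementSums A i₁ := by
  classical
  refine ⟨_, fun j => ?_, Finsupp.erase_same, rfl⟩
  by_cases hj : j = i₁
  · rw [hj, Finsupp.erase_same]
    exact h0 i₁
  · rw [Finsupp.erase_ne hj]
    exact hf j

theorem IsAdditiveSystem.exists_add_complementSums (hA : IsAdditiveSystem A) (i₁ : I) (n : ℕ) :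
    ∃ a ∈ A i₁, ∃ c ∈ complementSums A i₁, a + c = n := by
  obtain ⟨f, ⟨hf, rfl⟩, -⟩ := hA.2.2.2 n
  exact ⟨f i₁, hf i₁, _, erase_sum_mem_complementSums hA.2.1 hf,
    (f.sum_id_eq_add_erase i₁).symm⟩

theorem IsAdditiveSystem.complementSums_unique (hA : IsAdditiveSystem A) {a c a' c' : ℕ}
    (ha : a ∈ A i₁) (hc : c ∈ complementSums A i₁) (ha' : a' ∈ A i₁)
    (hc' : c' ∈ complementSums A i₁) (h : a + c = a' + c') : c = c' := by
  classical
  suffices a = a' by omega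
  obtain ⟨f, hf, hf1, rfl⟩ := hc
  obtain ⟨f', hf', hf1', rfl⟩ := hc'
  have mem {x : ℕ} {p : I →₀ ℕ} (hx : x ∈ A i₁) (hp : ∀ i, p i ∈ A i) (i : I) :
      (p.update i₁ x) i ∈ A i := by
    by_cases hi : i = i₁
    · subst hi
      simpa using hx
    · simpa [Finsupp.update, Function.update_of_ne hi] using hp i
  have sum {x : ℕ} {p : I →₀ ℕ} (hp : p i₁ = 0) :
      (p.update i₁ x).sum (fun _ x => x) = x + p.sum (fun _ x => x) := by
    rw [Finsupp.sum_id_eq_add_erase _ i₁, p.sum_id_eq_add_erase i₁, hp]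
    simp
  have := (hA.2.2.2 _).unique ⟨mem ha hf, rfl⟩ ⟨mem ha' hf', by rw [sum hf1, sum hf1', h]⟩
  simpa using DFunLike.congr_fun this i₁

theorem existsUnique_of_dilation {g : ℕ} (hg : 0 < g) (h0 : ∀ i, 0 ∈ A i)
    (hdvd : ∀ c ∈ complementSums A i₁, g ∣ c)
    (h : ∀ n : ℕ, ∃! f : I →₀ ℕ, (∀ i, f i ∈ A i) ∧ f.sum (fun _ x => x) = n) (n : ℕ) :
    ∃! f : I →₀ ℕ, (∀ i, g * f i ∈ A i) ∧ f.sum (fun _ x => x) = n := by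
  have sum (f : I →₀ ℕ) : (f.mapRange (g * ·) (mul_zero g)).sum (fun _ x => x) =
      g * f.sum (fun _ x => x) := by
    rw [Finsupp.sum_mapRange_index (fun _ => rfl), Finsupp.mul_sum]
  obtain ⟨f, ⟨hf, hfs⟩, -⟩ := h (g * n)
  have hdiv (i : I) : g ∣ f i := by
    by_cases hi : i = i₁
    · rw [hi]
      have h1 := f.sum_id_eq_add_erase i₁
      rw [hfs] at h1
      exact (Nat.dvd_add_left (hdvd _ (erase_sum_mem_complementSums h0 hf))).1
        (h1 ▸ Nat.dvd_mul_right g n)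
    · exact hdvd _ (mem_complementSums_of_mem h0 hi (hf i))
  have hfe : (f.mapRange (· / g) (Nat.zero_div g)).mapRange (g * ·) (mul_zero g) = f := by
    ext i
    simp [Nat.mul_div_cancel' (hdiv i)]
  refine ⟨f.mapRange (· / g) (Nat.zero_div g), ⟨fun i => ?_, ?_⟩, fun p ⟨hp, hps⟩ => ?_⟩
  · rw [Finsupp.mapRange_apply, Nat.mul_div_cancel' (hdiv i)]
    exact hf i
  · apply Nat.eq_of_mul_eq_mul_left hg
    rw [← sum, hfe, hfs]
  · have := (h (g * n)).unique (y₁ := p.mapRange (g * ·) (mul_zero g))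
      ⟨fun i => by simpa using hp i, by rw [sum, hps]⟩ ⟨hf, hfs⟩
    rw [← this]
    ext i
    simp [Nat.mul_div_cancel_left _ hg]

theorem existsUnique_subtype_of_eq_singleton_zero (hA : A i₁ = {0}) {n : ℕ}
    (h : ∃! f : I →₀ ℕ, (∀ i, f i ∈ A i) ∧ f.sum (fun _ x => x) = n) :
    ∃! f : {i : I // i ≠ i₁} →₀ ℕ,
      (∀ i : {i : I // i ≠ i₁}, f i ∈ A i) ∧ f.sum (fun _ x => x) = n := by
  classical
  have sum (f : {i : I // i ≠ i₁} →₀ ℕ) :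
      f.extendDomain.sum (fun _ x => x) = f.sum (fun _ x => x) := by
    rw [Finsupp.extendDomain_eq_embDomain_subtype, Finsupp.sum_embDomain]
  obtain ⟨f, ⟨hf, hfs⟩, hu⟩ := h
  have hfe : (f.subtypeDomain (· ≠ i₁)).extendDomain = f := by
    refine Finsupp.extendDomain_subtypeDomain f fun i hi hi1 => ?_
    have := hf i
    rw [hi1, hA] at this
    exact Finsupp.mem_support_iff.1 hi (hi1 ▸ this)
  refine ⟨f.subtypeDomain (· ≠ i₁), ⟨fun i => hf i.1, by rw [← sum, hfe, hfs]⟩,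
    fun p ⟨hp, hps⟩ => ?_⟩
  have := hu p.extendDomain ⟨fun i => ?_, by rw [sum, hps]⟩
  · rw [← this, Finsupp.subtypeDomain_extendDomain]
  · by_cases hi : i = i₁
    · subst hi
      simp [Finsupp.extendDomain, hA]
    · simpa [Finsupp.extendDomain, hi] using hp ⟨i, hi⟩

theorem IsAdditiveSystem.exists_one_mem (hA : IsAdditiveSystem A) : ∃ i, 1 ∈ A i := by
  obtain ⟨f, ⟨hf, hfs⟩, -⟩ := hA.2.2.2 1
  have hf0 : f ≠ 0 := by
    rintro rfl
    simp at hfs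
  obtain ⟨i, hi⟩ := DFunLike.ne_iff.1 hf0
  have := f.sum_id_eq_add_erase i
  have hi0 : f i ≠ 0 := hi
  refine ⟨i, ?_⟩
  rw [show 1 = f i by omega]
  exact hf i

end


/-- Lemma 3 (de Bruijn's fundamental lemma): if `A` is an additive system with at
least two indices, then there are `i₁ ∈ I`, `g ≥ 2` and a family `(B i)` of sets of
nonnegative integers containing `0` with `A i₁ = [0,g) ⊕ g ∗ B i₁` (with unique
representation) and `A i = g ∗ B i` for `i ≠ i₁`; moreover if `B i₁ = {0}` then
`(B i)_{i ≠ i₁}` is an additive system, and if `B i₁ ≠ {0}` then `(B i)_{i ∈ I}`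
is an additive system. -/
theorem deBruijn_fundamental_lemma {I : Type*} (A : I → Set ℕ)
    (hA : IsAdditiveSystem A) (hI : ∃ i j : I, i ≠ j) :
    ∃ (i₁ : I) (g : ℕ) (B : I → Set ℕ), 2 ≤ g ∧ (∀ i, 0 ∈ B i) ∧
      (A i₁ = {n | ∃ u < g, ∃ b ∈ B i₁, n = u + g * b} ∧
        ∀ u < g, ∀ b ∈ B i₁, ∀ u' < g, ∀ b' ∈ B i₁,
          u + g * b = u' + g * b' → u = u' ∧ b = b') ∧
      (∀ i, i ≠ i₁ → A i = (fun x => g * x) '' B i) ∧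
      (B i₁ = {0} → IsAdditiveSystem (fun i : {i : I // i ≠ i₁} => B i)) ∧
      (B i₁ ≠ {0} → IsAdditiveSystem B) := by
  have h0 := hA.2.1
  obtain ⟨i₁, h1⟩ := hA.exists_one_mem
  obtain ⟨i₂, hi₂⟩ : ∃ i, i ≠ i₁ := by
    obtain ⟨i, j, hij⟩ := hI
    by_cases hi : i = i₁
    · exact ⟨j, fun hj => hij (hi.trans hj.symm)⟩
    · exact ⟨i, hi⟩
  obtain ⟨c, hc, hc0⟩ := (hA.2.2.1 i₂).exists_ne 0
  obtain ⟨g, hg, hdvd, hblock⟩ := exists_block_length (C := complementSums A i₁) (h0 i₁) h1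
    ⟨0, h0, rfl, rfl⟩ ⟨c, mem_complementSums_of_mem h0 hi₂ hc, hc0⟩
    (hA.exists_add_complementSums i₁)
    (fun _ ha _ hc _ ha' _ hc' => hA.complementSums_unique ha hc ha' hc')
  have hg0 : 0 < g := by omega
  have himage (i : I) (hi : i ≠ i₁) : A i = (fun x => g * x) '' {b | g * b ∈ A i} := by
    ext n
    constructor
    · intro hn
      obtain ⟨b, rfl⟩ := hdvd n (mem_complementSums_of_mem h0 hi hn)
      exact ⟨b, hn, rfl⟩
    · rintro ⟨b, hb, rfl⟩
      exact hb
  have hnontriv (i : I) (hi : i ≠ i₁) : {b | g * b ∈ A i}.Nontrivial := by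
    have := hA.2.2.1 i
    rw [himage i hi] at this
    exact Set.nontrivial_of_image _ _ this
  have hunique := existsUnique_of_dilation hg0 h0 hdvd hA.2.2.2
  refine ⟨i₁, g, fun i => {b | g * b ∈ A i}, hg, h0, ⟨?_, ?_⟩, himage, fun h => ?_, fun h => ?_⟩
  · ext n
    constructor
    · intro hn
      have hr := Nat.mod_lt n hg0
      refine ⟨n % g, hr, n / g, (hblock _ _ hr).1 ?_, (Nat.mod_add_div n g).symm⟩
      rwa [Nat.div_add_mod]
    · rintro ⟨u, hu, b, hb, rfl⟩
      rw [Nat.add_comm]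
      exact (hblock b u hu).2 hb
  · intro u hu b _ u' hu' b' _ h
    have huu : u = u' := by
      simpa [Nat.add_mul_mod_self_left, Nat.mod_eq_of_lt hu, Nat.mod_eq_of_lt hu'] using
        congrArg (· % g) h
    exact ⟨huu, Nat.eq_of_mul_eq_mul_left hg0 (by omega)⟩
  · exact ⟨⟨i₂, hi₂⟩, fun i => h0 i, fun i => hnontriv i i.2,
      fun n => existsUnique_subtype_of_eq_singleton_zero
        (A := fun i => {b | g * b ∈ A i}) h (hunique n)⟩
  · refine ⟨hA.1, h0, fun i => ?_, hunique⟩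
    by_cases hi : i = i₁
    · subst hi
      exact (Set.nontrivial_iff_ne_singleton (s := {b | g * b ∈ A i}) (h0 i)).2 h
    · exact hnontriv i hi
end

section
/- Let a and b be positive integers, and let X be a set of integers. Then [0,ab) = [0,a) ⊕ X (i.e., every element of [0,ab) is uniquely the sum of an element of [0,a) and an element of X, and every such sum lies in [0,ab)) if and only if X = a∗[0,b). -/
/-- `UniqueSumset B C A` means `A = B ⊕ C`: the sumset `B + C` equals `A` and every
element of `A` has a unique representation `b + c` with `b ∈ B`, `c ∈ C`. -/
def UniqueSumset (B C A : Set ℤ) : Prop :=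
  A = {n | ∃ b ∈ B, ∃ c ∈ C, n = b + c} ∧
    ∀ b ∈ B, ∀ c ∈ C, ∀ b' ∈ B, ∀ c' ∈ C, b + c = b' + c' → b = b' ∧ c = c'

/-- A set of integers is decomposable if it is `B ⊕ C` with `|B| ≥ 2` and `|C| ≥ 2`. -/
def DecomposableSet (A : Set ℤ) : Prop :=
  ∃ B C : Set ℤ, B.Nontrivial ∧ C.Nontrivial ∧ UniqueSumset B C A

/-- If `[0, a) ⊕ X = [0, ab)`, then `X` contains every multiple `ka` with `0 ≤ k < b`. -/
lemma UniqueSumset.mul_natCast_mem {a b : ℤ} (ha : 0 < a) {X : Set ℤ}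
    (h : UniqueSumset (Set.Ico 0 a) X (Set.Ico 0 (a * b))) (k : ℕ) (hk : (k : ℤ) < b) :
    a * k ∈ X := by
  obtain ⟨hsum, huniq⟩ := h
  have hnonneg : ∀ x ∈ X, 0 ≤ x := fun x hx => by
    have hmem : x ∈ Set.Ico 0 (a * b) := by
      rw [hsum]
      exact ⟨0, ⟨le_rfl, ha⟩, x, hx, (zero_add x).symm⟩
    exact hmem.1
  have hrep : ∀ n ∈ Set.Ico 0 (a * b), ∃ r ∈ Set.Ico 0 a, ∃ x ∈ X, n = r + x := fun n hn => by
    rwa [hsum] at hn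
  induction k with
  | zero =>
    obtain ⟨r, hr, x, hx, hrx⟩ := hrep 0 ⟨le_rfl, mul_pos ha (by simpa using hk)⟩
    have hx0 : x = 0 := by linarith [hr.1, hnonneg x hx]
    simpa [hx0] using hx
  | succ k ih =>
    push_cast at hk ⊢
    have hkX := ih (by lia)
    obtain ⟨r, ⟨hr0, hra⟩, x, hx, hrx⟩ :=
      hrep (a * (k + 1)) ⟨by positivity, mul_lt_mul_of_pos_left hk ha⟩
    rcases hr0.eq_or_lt with rfl | hr
    · simpa [hrx] using hx
    · have := (huniq (x - a * k) ⟨by linarith, by linarith⟩ (a * k) hkX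
        0 ⟨le_rfl, ha⟩ x hx (by ring)).1
      linarith

/-- Lemma 4: for positive integers `a`, `b` and a set `X` of integers,
`[0, ab) = [0, a) ⊕ X` if and only if `X = a ∗ [0, b)`. -/
theorem interval_eq_interval_oplus_iff (a b : ℤ) (ha : 0 < a) (hb : 0 < b)
    (X : Set ℤ) :
    UniqueSumset (Set.Ico 0 a) X (Set.Ico 0 (a * b)) ↔
      X = (fun x => a * x) '' Set.Ico 0 b := by
  have hquot : ∀ n ∈ Set.Ico 0 (a * b), n / a ∈ Set.Ico 0 b := fun n hn =>
    ⟨Int.ediv_nonneg hn.1 ha.le, Int.ediv_lt_of_lt_mul ha (by linarith [hn.2, mul_comm a b])⟩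
  have hrem : ∀ n : ℤ, n % a ∈ Set.Ico 0 a := fun n =>
    ⟨Int.emod_nonneg n ha.ne', Int.emod_lt_of_pos n ha⟩
  constructor
  · intro h
    have hmul : ∀ k ∈ Set.Ico 0 b, a * k ∈ X := fun k hk => by
      lift k to ℕ using hk.1
      exact h.mul_natCast_mem ha k hk.2
    ext x
    constructor
    · intro hx
      have hxab : x ∈ Set.Ico 0 (a * b) := by
        rw [h.1]
        exact ⟨0, ⟨le_rfl, ha⟩, x, hx, (zero_add x).symm⟩
      refine ⟨x / a, hquot x hxab, ?_⟩
      exact (h.2 (x % a) (hrem x) (a * (x / a)) (hmul _ (hquot x hxab))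
        0 ⟨le_rfl, ha⟩ x hx (by rw [Int.emod_add_mul_ediv, zero_add])).2
    · rintro ⟨k, hk, rfl⟩
      exact hmul k hk
  · rintro rfl
    constructor
    · ext n
      constructor
      · intro hn
        exact ⟨n % a, hrem n, a * (n / a), ⟨n / a, hquot n hn, rfl⟩,
          (Int.emod_add_mul_ediv n a).symm⟩
      · rintro ⟨r, ⟨hr0, hra⟩, _, ⟨k, ⟨hk0, hkb⟩, rfl⟩, rfl⟩
        refine ⟨by positivity, ?_⟩
        have := mul_le_mul_of_nonneg_left (Int.add_one_le_iff.mpr hkb) ha.le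
        dsimp only
        linarith
    · rintro r ⟨hr0, hra⟩ _ ⟨k, -, rfl⟩ r' ⟨hr0', hra'⟩ _ ⟨k', -, rfl⟩ h
      have hr : r = r' := by
        simpa [Int.emod_eq_of_lt, hr0, hra, hr0', hra'] using congrArg (· % a) h
      exact ⟨hr, by simpa [hr] using h⟩
end

section
/- Let B = (B_j)_{j∈ℕ} be the British number system constructed from an integer sequence (h_j)_{j∈ℕ} with h_j ≥ 2 for all j, and let A = (A_i)_{i∈ℕ} be the contraction of B constructed from a partition (J_i)_{i∈ℕ} of ℕ into pairwise disjoint nonempty finite sets, i.e., A_i = Σ_{j∈J_i} B_j. Then A is a British number system (generated by some integer sequence (g_i)_{i∈ℕ} with g_i ≥ 2) if and only if J_i is a finite interval of integers for every i ∈ ℕ. -/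
/-- The `j`-th place value `h 0 * ⋯ * h (j - 1)` of the mixed-radix system with bases `h`. -/
def placeValue (h : ℕ → ℕ) (j : ℕ) : ℕ := ∏ i ∈ Finset.range j, h i

/-- The `j`-th mixed-radix digit of `n`. -/
def mixedDigit (h : ℕ → ℕ) (n j : ℕ) : ℕ := n / placeValue h j % h j

section MixedRadix

variable {h : ℕ → ℕ}

theorem placeValue_succ (h : ℕ → ℕ) (j : ℕ) :
    placeValue h (j + 1) = placeValue h j * h j :=
  Finset.prod_range_succ _ _

theorem placeValue_dvd (h : ℕ → ℕ) {a b : ℕ} (hab : a ≤ b) :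
    placeValue h a ∣ placeValue h b :=
  Finset.prod_dvd_prod_of_subset _ _ _ (Finset.range_subset_range.2 hab)

theorem placeValue_pos (hh : ∀ j, 2 ≤ h j) (j : ℕ) : 0 < placeValue h j :=
  Finset.prod_pos fun i _ => by have := hh i; omega

theorem placeValue_strictMono (hh : ∀ j, 2 ≤ h j) : StrictMono (placeValue h) := by
  refine strictMono_nat_of_lt_succ fun j => ?_
  rw [placeValue_succ]
  have := placeValue_pos hh j
  have := hh j
  nlinarith

theorem sum_mixedDigit (h : ℕ → ℕ) (n t : ℕ) :
    ∑ j ∈ Finset.range t, placeValue h j * mixedDigit h n j = n % placeValue h t := by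
  induction t with
  | zero => simp [placeValue, Nat.mod_one]
  | succ t ih => rw [Finset.sum_range_succ, ih, placeValue_succ, Nat.mod_mul, mixedDigit]

theorem mixedDigit_eq_zero_of_lt {n j : ℕ} (hn : n < placeValue h j) : mixedDigit h n j = 0 := by
  simp [mixedDigit, Nat.div_eq_of_lt hn]

theorem mixedDigit_eq_zero_of_dvd (hh : ∀ j, 2 ≤ h j) {n j : ℕ}
    (hn : placeValue h (j + 1) ∣ n) : mixedDigit h n j = 0 := by
  obtain ⟨m, rfl⟩ := hn
  rw [mixedDigit, placeValue_succ, mul_assoc, Nat.mul_div_cancel_left _ (placeValue_pos hh j),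
    Nat.mul_mod_right]

theorem mixedDigit_placeValue_self (hh : ∀ j, 2 ≤ h j) (a : ℕ) :
    mixedDigit h (placeValue h a) a = 1 := by
  rw [mixedDigit, Nat.div_self (placeValue_pos hh a), Nat.mod_eq_of_lt (hh a)]

theorem mixedDigit_placeValue_of_ne (hh : ∀ j, 2 ≤ h j) {a j : ℕ} (hne : j ≠ a) :
    mixedDigit h (placeValue h a) j = 0 := by
  rcases hne.lt_or_gt with hlt | hlt
  · exact mixedDigit_eq_zero_of_dvd hh (placeValue_dvd h hlt)
  · exact mixedDigit_eq_zero_of_lt (placeValue_strictMono hh hlt)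

theorem sum_placeValue_mul_lt {d : ℕ → ℕ} (hd : ∀ j, d j < h j) (k : ℕ) :
    ∑ j ∈ Finset.range k, placeValue h j * d j < placeValue h k := by
  induction k with
  | zero => simp [placeValue]
  | succ k ih =>
    rw [Finset.sum_range_succ, placeValue_succ]
    have := Nat.mul_le_mul_left (placeValue h k) (Nat.succ_le_of_lt (hd k))
    rw [Nat.mul_succ] at this
    omega

theorem mixedDigit_sum (hh : ∀ j, 2 ≤ h j) {d : ℕ → ℕ} (hd : ∀ j, d j < h j)
    {N k : ℕ} (hk : k < N) :
    mixedDigit h (∑ j ∈ Finset.range N, placeValue h j * d j) k = d k := by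
  obtain ⟨M, hM⟩ : placeValue h (k + 1) ∣
      ∑ j ∈ Finset.Ico (k + 1) N, placeValue h j * d j :=
    Finset.dvd_sum fun j hj =>
      (placeValue_dvd h (Finset.mem_Ico.1 hj).1).mul_right _
  rw [← Finset.sum_range_add_sum_Ico _ (Nat.succ_le_of_lt hk), Nat.succ_eq_add_one, hM,
    Finset.sum_range_succ, placeValue_succ, mixedDigit, add_assoc, mul_assoc, ← mul_add,
    Nat.add_mul_div_left _ _ (placeValue_pos hh k),
    Nat.div_eq_of_lt (sum_placeValue_mul_lt hd k), zero_add, Nat.add_mul_mod_self_left,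
    Nat.mod_eq_of_lt (hd k)]

theorem mem_famSum_BNS_iff (hh : ∀ j, 2 ≤ h j) (T : Set ℕ) (n : ℕ) :
    n ∈ famSum (BNS h) T ↔ ∀ j, j ∉ T → mixedDigit h n j = 0 := by
  constructor
  · rintro ⟨f, hf, hfT, rfl⟩ j hj
    choose d hd hfd using hf
    have hfd' : ∀ i, f i = placeValue h i * d i := fun i => (hfd i).symm
    obtain ⟨N, hN⟩ := f.support.exists_nat_subset_range
    have hsum : f.sum (fun _ x => x) =
        ∑ i ∈ Finset.range (N + j + 1), placeValue h i * d i := by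
      rw [Finsupp.sum_of_support_subset f
        (hN.trans (Finset.range_subset_range.2 (by omega : N ≤ N + j + 1))) _ (by simp)]
      exact Finset.sum_congr rfl fun i _ => hfd' i
    rw [hsum, mixedDigit_sum hh hd (by omega)]
    have h0 := hfT j hj
    rw [hfd'] at h0
    exact (Nat.mul_eq_zero.1 h0).resolve_left (placeValue_pos hh j).ne'
  · intro hn
    have hlt : ∀ j, n < j → n < placeValue h j := fun j hj =>
      hj.trans_le (placeValue_strictMono hh).le_apply
    have hsupp : ∀ j, placeValue h j * mixedDigit h n j ≠ 0 → j ∈ Finset.range (n + 1) := by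
      intro j hj
      by_contra hjn
      rw [Finset.mem_range] at hjn
      exact hj (by rw [mixedDigit_eq_zero_of_lt (hlt j (by omega)), mul_zero])
    refine ⟨Finsupp.onFinset (Finset.range (n + 1)) _ hsupp, fun j => ?_, fun j hj => ?_, ?_⟩
    · exact ⟨mixedDigit h n j, Nat.mod_lt _ (by have := hh j; omega), rfl⟩
    · simp [hn j hj]
    · rw [Finsupp.onFinset_sum _ (fun _ => rfl), sum_mixedDigit,
        Nat.mod_eq_of_lt (hlt _ n.lt_succ_self)]

theorem placeValue_mem_famSum_BNS_iff (hh : ∀ j, 2 ≤ h j) (T : Set ℕ) (a : ℕ) :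
    placeValue h a ∈ famSum (BNS h) T ↔ a ∈ T := by
  rw [mem_famSum_BNS_iff hh]
  constructor
  · intro H
    by_contra ha
    have := H a ha
    rw [mixedDigit_placeValue_self hh] at this
    omega
  · exact fun ha j hj => mixedDigit_placeValue_of_ne hh fun hja => hj (hja ▸ ha)

theorem mem_famSum_BNS_Ico_iff (hh : ∀ j, 2 ≤ h j) {s t : ℕ} (hst : s ≤ t) (n : ℕ) :
    n ∈ famSum (BNS h) (Set.Ico s t) ↔ placeValue h s ∣ n ∧ n < placeValue h t := by
  rw [mem_famSum_BNS_iff hh]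
  constructor
  · intro H
    constructor
    · rw [Nat.dvd_iff_mod_eq_zero, ← sum_mixedDigit]
      refine Finset.sum_eq_zero fun j hj => ?_
      rw [H j fun hj' => absurd hj'.1 (Finset.mem_range.1 hj).not_ge, mul_zero]
    · have hn : n < placeValue h (n + t + 1) :=
        lt_of_lt_of_le (by omega) (placeValue_strictMono hh).le_apply
      have hsum := sum_mixedDigit h n (n + t + 1)
      rw [Nat.mod_eq_of_lt hn, ← Finset.sum_range_add_sum_Ico _ (by omega : t ≤ n + t + 1),
        sum_mixedDigit, Finset.sum_eq_zero, add_zero] at hsum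
      · rw [← hsum]
        exact Nat.mod_lt _ (placeValue_pos hh t)
      · intro j hj
        rw [H j fun hj' => absurd hj'.2 (Finset.mem_Ico.1 hj).1.not_gt, mul_zero]
  · rintro ⟨hdvd, hlt⟩ j hj
    rcases lt_or_ge j s with hjs | hjs
    · exact mixedDigit_eq_zero_of_dvd hh ((placeValue_dvd h hjs).trans hdvd)
    · have htj : t ≤ j := not_lt.1 fun hjt => hj ⟨hjs, hjt⟩
      exact mixedDigit_eq_zero_of_lt
        (hlt.trans_le ((placeValue_strictMono hh).monotone htj))

theorem famSum_BNS_Ico (hh : ∀ j, 2 ≤ h j) {s t : ℕ} (hst : s ≤ t) :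
    famSum (BNS h) (Set.Ico s t) =
      (fun x => placeValue h s * x) '' {x | x < ∏ j ∈ Finset.Ico s t, h j} := by
  have hmul : placeValue h s * ∏ j ∈ Finset.Ico s t, h j = placeValue h t :=
    Finset.prod_range_mul_prod_Ico h hst
  ext n
  rw [mem_famSum_BNS_Ico_iff hh hst, ← hmul]
  constructor
  · rintro ⟨⟨x, rfl⟩, hx⟩
    exact ⟨x, Nat.lt_of_mul_lt_mul_left hx, rfl⟩
  · rintro ⟨x, hx, rfl⟩
    exact ⟨dvd_mul_right _ _, Nat.mul_lt_mul_of_pos_left hx (placeValue_pos hh s)⟩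

/-- If the sumset over `T` is one of the sets of a British number system, then `T` has no gaps. -/
theorem ordConnected_of_famSum_BNS_eq (hh : ∀ j, 2 ≤ h j) {g : ℕ → ℕ} {T : Set ℕ} {i : ℕ}
    (hT : famSum (BNS h) T = BNS g i) : T.OrdConnected := by
  refine ⟨fun u hu v hv w hw => ?_⟩
  rw [← placeValue_mem_famSum_BNS_iff hh, hT] at hu hv ⊢
  obtain ⟨x, -, hx⟩ := hu
  obtain ⟨y, hy, hy'⟩ := hv
  obtain ⟨m, hm⟩ := placeValue_dvd h hw.1
  have hle := (placeValue_strictMono hh).monotone hw.2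
  have hpos := placeValue_pos hh v
  simp only at hx hy'
  rw [← hx, mul_assoc] at hm
  refine ⟨x * m, Set.mem_ofPred.2 (lt_of_le_of_lt ?_ hy), hm.symm⟩
  rw [hm, ← hy'] at hle
  refine Nat.le_of_mul_le_mul_left hle (Nat.pos_of_ne_zero fun h0 => ?_)
  rw [← hy', h0, zero_mul] at hpos
  exact hpos.false

end MixedRadix

theorem exists_eq_Icc_of_ordConnected {T : Set ℕ} (hT : T.OrdConnected) (hfin : T.Finite)
    (hne : T.Nonempty) : ∃ u v, T = Set.Icc u v := by
  obtain ⟨u, hu, hu'⟩ := T.exists_min_image id hfin hne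
  obtain ⟨v, hv, hv'⟩ := T.exists_max_image id hfin hne
  exact ⟨u, v, Set.Subset.antisymm (fun x hx => ⟨hu' x hx, hv' x hx⟩) (hT.out hu hv)⟩

/-- A partition of `ℕ` into finite intervals can be listed in increasing order. -/
theorem exists_equiv_eq_Ico_of_partition {J : ℕ → Set ℕ} (hJ : IsPartitionFam J)
    (hI : ∀ i, ∃ u v : ℕ, J i = Set.Icc u v) :
    ∃ (t : ℕ → ℕ) (σ : ℕ ≃ ℕ), t 0 = 0 ∧ StrictMono t ∧
      ∀ k, J (σ k) = Set.Ico (t k) (t (k + 1)) := by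
  obtain ⟨hne, hdisj, hun⟩ := hJ
  have hmem : ∀ n, ∃ i, n ∈ J i := fun n => Set.mem_iUnion.1 (hun ▸ Set.mem_univ n)
  have huniq : ∀ {n i i'}, n ∈ J i → n ∈ J i' → i = i' := fun {n i i'} hn hn' => by
    by_contra hii
    exact Set.disjoint_left.1 (hdisj hii) hn hn'
  choose b hb using hmem
  choose u v huv using hI
  let t : ℕ → ℕ := fun k => Nat.rec 0 (fun _ n => v (b n) + 1) k
  have ht : ∀ k, t (k + 1) = v (b (t k)) + 1 := fun _ => rfl
  have hbnd : ∀ n, u (b n) ≤ n ∧ n ≤ v (b n) := fun n => by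
    have := hb n
    rwa [huv] at this
  have hmono : StrictMono t := strictMono_nat_of_lt_succ fun k => by
    have := hbnd (t k)
    rw [ht]
    omega
  have hleft : ∀ k, u (b (t k)) = t k := by
    intro k
    refine le_antisymm (hbnd _).1 ?_
    cases k with
    | zero => exact Nat.zero_le _
    | succ k =>
      by_contra hlt
      have h₁ := hbnd (t k)
      have h₂ := hbnd (t (k + 1))
      have hk := ht k
      have hv₁ : v (b (t k)) ∈ J (b (t k)) := by
        rw [huv]
        exact ⟨h₁.1.trans h₁.2, le_rfl⟩
      have hv₂ : v (b (t k)) ∈ J (b (t (k + 1))) := by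
        rw [huv]
        constructor <;> omega
      have := huniq hv₁ hv₂
      rw [← this] at h₂
      omega
  have hblock : ∀ k, J (b (t k)) = Set.Ico (t k) (t (k + 1)) := by
    intro k
    rw [huv, hleft, ht]
    ext x
    simp only [Set.mem_Icc, Set.mem_Ico]
    omega
  have hinj : Function.Injective fun k => b (t k) := by
    intro k k' hkk
    refine hmono.injective ?_
    rw [← hleft k, ← hleft k']
    exact congrArg u hkk
  have hsurj : Function.Surjective fun k => b (t k) := by
    intro i
    obtain ⟨x, hx⟩ := hne i
    have hex : ∃ k, x < t (k + 1) := ⟨x, lt_of_lt_of_le x.lt_succ_self hmono.le_apply⟩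
    refine ⟨Nat.find hex, huniq (n := x) ?_ hx⟩
    rw [hblock]
    refine ⟨?_, Nat.find_spec hex⟩
    cases hf : Nat.find hex with
    | zero => exact Nat.zero_le _
    | succ k => exact not_lt.1 (Nat.find_min hex (by omega))
  exact ⟨t, Equiv.ofBijective _ ⟨hinj, hsurj⟩, rfl, hmono, hblock⟩

theorem prod_range_prod_Ico_eq_placeValue (h : ℕ → ℕ) {t : ℕ → ℕ} (ht0 : t 0 = 0)
    (ht : Monotone t) (k : ℕ) :
    ∏ i ∈ Finset.range k, ∏ j ∈ Finset.Ico (t i) (t (i + 1)), h j = placeValue h (t k) := by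
  induction k with
  | zero => simp [ht0, placeValue]
  | succ k ih =>
    rw [Finset.prod_range_succ, ih]
    exact Finset.prod_range_mul_prod_Ico h (ht k.le_succ)

/-- Theorem 4: a contraction `A` of a British number system `BNS h`, built from a
partition `(J i)_{i ∈ ℕ}` of `ℕ` into pairwise disjoint nonempty finite sets, is a
British number system (up to re-indexing, i.e. generated by some sequence
`(g_i)` with `g_i ≥ 2`) if and only if every `J i` is a finite interval of
integers. -/
theorem contraction_of_bns_is_bns_iff (h : ℕ → ℕ) (hh : ∀ j, 2 ≤ h j)
    (J : ℕ → Set ℕ) (hJ : IsPartitionFam J) (hJfin : ∀ i, (J i).Finite)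
    (A : ℕ → Set ℕ) (hA : ∀ i, A i = famSum (BNS h) (J i)) :
    (∃ g : ℕ → ℕ, (∀ i, 2 ≤ g i) ∧ ∃ σ : ℕ ≃ ℕ, ∀ i, A (σ i) = BNS g i) ↔
      ∀ i, ∃ u v : ℕ, J i = Set.Icc u v := by
  constructor
  · rintro ⟨g, -, σ, hσ⟩ i
    refine exists_eq_Icc_of_ordConnected ?_ (hJfin i) (hJ.1 i)
    refine ordConnected_of_famSum_BNS_eq hh (g := g) (i := σ.symm i) ?_
    rw [← hσ, σ.apply_symm_apply, hA]
  · intro hI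
    obtain ⟨t, σ, ht0, ht, hσ⟩ := exists_equiv_eq_Ico_of_partition hJ hI
    refine ⟨fun k => ∏ j ∈ Finset.Ico (t k) (t (k + 1)), h j, fun k => ?_, σ, fun k => ?_⟩
    · have hmem : t k ∈ Finset.Ico (t k) (t (k + 1)) :=
        Finset.mem_Ico.2 ⟨le_rfl, ht k.lt_succ_self⟩
      exact (hh _).trans (Nat.le_of_dvd
        (Finset.prod_pos fun i _ => by have := hh i; omega) (Finset.dvd_prod_of_mem h hmem))
    · rw [hA, hσ, famSum_BNS_Ico hh (ht k.lt_succ_self).le, BNS,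
        prod_range_prod_Ico_eq_placeValue h ht0 ht.monotone]
end

section
/- Let (g_i)_{i∈ℕ} be a sequence of integers with g_i ≥ 2 for all i, and let G be the British number system generated by (g_i). Then G is indecomposable (every set G_{i-1}∗[0,g_i) is an indecomposable set) if and only if g_i is a prime number for every i ∈ ℕ. -/
theorem UniqueSumset.ncard_mul_ncard {A B C : Set ℤ} (h : UniqueSumset B C A) :
    B.ncard * C.ncard = A.ncard := by
  obtain ⟨rfl, huniq⟩ := h
  have himage : {n | ∃ b ∈ B, ∃ c ∈ C, n = b + c} = (fun p : ℤ × ℤ => p.1 + p.2) '' (B ×ˢ C) := by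
    ext n
    constructor
    · rintro ⟨b, hb, c, hc, rfl⟩
      exact ⟨(b, c), ⟨hb, hc⟩, rfl⟩
    · rintro ⟨⟨b, c⟩, ⟨hb, hc⟩, rfl⟩
      exact ⟨b, hb, c, hc, rfl⟩
  rw [himage, Set.InjOn.ncard_image, Set.ncard_prod]
  rintro ⟨b, c⟩ ⟨hb, hc⟩ ⟨b', c'⟩ ⟨hb', hc'⟩ heq
  exact Prod.ext_iff.mpr (huniq b hb c hc b' hb' c' hc' heq)

theorem not_decomposableSet_of_prime_ncard {A : Set ℤ} (hA : A.ncard.Prime) :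
    ¬ DecomposableSet A := by
  rintro ⟨B, C, hB, hC, h⟩
  rw [← h.ncard_mul_ncard, Nat.prime_mul_iff] at hA
  rcases hA with ⟨-, h1⟩ | ⟨-, h1⟩
  · obtain ⟨c, rfl⟩ := Set.ncard_eq_one.mp h1
    exact Set.not_nontrivial_singleton hC
  · obtain ⟨b, rfl⟩ := Set.ncard_eq_one.mp h1
    exact Set.not_nontrivial_singleton hB

theorem ncard_natCast_image_mul_image_Iio {m : ℕ} (hm : 0 < m) (n : ℕ) :
    (((↑) : ℕ → ℤ) '' ((fun x => m * x) '' {x | x < n})).ncard = n := by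
  rw [Set.ncard_image_of_injective _ Nat.cast_injective,
    Set.ncard_image_of_injective _ (mul_right_injective₀ hm.ne')]
  exact Set.ncard_Iio_nat n

theorem nontrivial_natCast_image_mul_image_Iio {m n : ℕ} (hm : 0 < m) (hn : 2 ≤ n) :
    (((↑) : ℕ → ℤ) '' ((fun x => m * x) '' {x | x < n})).Nontrivial :=
  Set.Nontrivial.image (Set.Nontrivial.image ⟨0, by simp; omega, 1, by simp; omega, zero_ne_one⟩
    (mul_right_injective₀ hm.ne')) Nat.cast_injective

theorem decomposableSet_dilate_mul {m a b : ℕ} (hm : 0 < m) (ha : 2 ≤ a) (hb : 2 ≤ b) :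
    DecomposableSet (((↑) : ℕ → ℤ) '' ((fun x => m * x) '' {x | x < a * b})) := by
  have ha0 : 0 < a := by omega
  refine ⟨_, _, nontrivial_natCast_image_mul_image_Iio hm ha,
    nontrivial_natCast_image_mul_image_Iio (Nat.mul_pos hm ha0) hb, ?_, ?_⟩
  · ext n
    constructor
    · rintro ⟨_, ⟨x, hx, rfl⟩, rfl⟩
      refine ⟨_, ⟨_, ⟨x % a, Nat.mod_lt _ ha0, rfl⟩, rfl⟩,
        _, ⟨_, ⟨x / a, Nat.div_lt_of_lt_mul hx, rfl⟩, rfl⟩, ?_⟩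
      dsimp only
      rw [← Nat.cast_add, mul_assoc, ← mul_add, Nat.mod_add_div]
    · rintro ⟨_, ⟨_, ⟨x, hx, rfl⟩, rfl⟩, _, ⟨_, ⟨y, hy, rfl⟩, rfl⟩, rfl⟩
      refine ⟨_, ⟨x + a * y, ?_, rfl⟩, by push_cast; ring⟩
      simp only [Set.mem_ofPred_eq] at hx hy ⊢
      nlinarith [Nat.mul_le_mul_left a (Nat.succ_le_of_lt hy)]
  · rintro _ ⟨_, ⟨x, hx, rfl⟩, rfl⟩ _ ⟨_, ⟨y, hy, rfl⟩, rfl⟩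
      _ ⟨_, ⟨x', hx', rfl⟩, rfl⟩ _ ⟨_, ⟨y', hy', rfl⟩, rfl⟩ h
    simp only [Set.mem_ofPred_eq] at hx hx'
    dsimp only at h
    have heq : x + a * y = x' + a * y' := by
      rw [← Nat.cast_add, ← Nat.cast_add, Nat.cast_inj, mul_assoc, mul_assoc, ← mul_add,
        ← mul_add] at h
      exact Nat.eq_of_mul_eq_mul_left hm h
    have hxx : x = x' := by
      simpa [Nat.add_mul_mod_self_left, Nat.mod_eq_of_lt hx, Nat.mod_eq_of_lt hx'] using
        congrArg (· % a) heq
    subst hxx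
    have hyy : y = y' := Nat.eq_of_mul_eq_mul_left ha0 (Nat.add_left_cancel heq)
    subst hyy
    exact ⟨rfl, rfl⟩

/-- The British number system generated by `(g_i)` is indecomposable (every set
`G_{i-1} ∗ [0, g_i)`, viewed as a set of integers, is indecomposable) if and only
if every `g_i` is prime. -/
theorem bns_indecomposable_iff_prime (g : ℕ → ℕ) (hg : ∀ i, 2 ≤ g i) :
    (∀ i, ¬ DecomposableSet (((↑) : ℕ → ℤ) '' BNS g i)) ↔
      ∀ i, Nat.Prime (g i) := by
  have hpos (i : ℕ) : 0 < ∏ j ∈ Finset.range i, g j :=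
    Finset.prod_pos fun j _ => zero_lt_two.trans_le (hg j)
  refine ⟨fun h i => ?_, fun h i => not_decomposableSet_of_prime_ncard ?_⟩
  · by_contra hp
    obtain ⟨a, b, ha, hb, hab⟩ := (Nat.not_prime_iff_exists_mul_eq (hg i)).mp hp
    have ha2 : 2 ≤ a := by
      by_contra! hlt
      interval_cases a <;> omega
    have hb2 : 2 ≤ b := by
      by_contra! hlt
      interval_cases b <;> omega
    apply h i
    rw [BNS, ← hab]
    exact decomposableSet_dilate_mul (hpos i) ha2 hb2
  · rw [BNS, ncard_natCast_image_mul_image_Iio (hpos i)]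
    exact h i
end

section
/- Let (g_i)_{i∈ℕ} be a sequence of integers with g_i ≥ 2 for all i, suppose g_k = rs for some k ∈ ℕ with integers r ≥ 2 and s ≥ 2, and let A be the British number system generated by (g_i). Define (g'_i)_{i∈ℕ} by g'_i = g_i for i ≤ k−1, g'_k = r, g'_{k+1} = s, and g'_i = g_{i-1} for i ≥ k+2, and let A' be the British number system generated by (g'_i). Then A is a proper contraction of A': explicitly, G_{i-1}∗[0,g_i) = G'_{i-1}∗[0,g'_i) for i ≤ k−1, G_{i-1}∗[0,g_i) = G'_i∗[0,g'_{i+1}) for i ≥ k+1, and G_{k-1}∗[0,g_k) = G'_{k-1}∗[0,g'_k) + G'_k∗[0,g'_{k+1}). -/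
open scoped Pointwise

/-- The sets of the British number system depend only on the partial product and the digit bound. -/
theorem BNS_congr {g g' : ℕ → ℕ} {i j : ℕ}
    (hprod : ∏ l ∈ Finset.range i, g l = ∏ l ∈ Finset.range j, g' l) (hdigit : g i = g' j) :
    BNS g i = BNS g' j := by
  simp only [BNS, hprod, hdigit]

/-- Mixed-radix decomposition: multiples of `P` with digit below `r * s` split into two digits. -/
theorem image_mul_lt_mul (P s : ℕ) {r : ℕ} (hr : 0 < r) :
    (fun x => P * x) '' {x | x < r * s} =
      (fun x => P * x) '' {x | x < r} + (fun x => P * r * x) '' {x | x < s} := by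
  ext n
  simp only [Set.mem_add, Set.mem_image, Set.mem_ofPred_eq]
  constructor
  · rintro ⟨x, hx, rfl⟩
    refine ⟨_, ⟨x % r, Nat.mod_lt x hr, rfl⟩, _, ⟨x / r, Nat.div_lt_of_lt_mul hx, rfl⟩, ?_⟩
    rw [mul_assoc, ← mul_add, Nat.mod_add_div]
  · rintro ⟨_, ⟨a, ha, rfl⟩, _, ⟨b, hb, rfl⟩, rfl⟩
    refine ⟨a + r * b, ?_, by ring⟩
    calc a + r * b < r + r * b := by gcongr
      _ = r * (b + 1) := by ring
      _ ≤ r * s := Nat.mul_le_mul_left r hb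

/-- If `g_k = r s` with `r, s ≥ 2`, and `g'` is obtained from `g` by replacing the
entry `g_k` by the two consecutive entries `r, s`, then the British number system
generated by `g` is a proper contraction of the one generated by `g'`: the sets
agree away from position `k` (with a shift), and the `k`-th set of `BNS g` is the
sumset of the `k`-th and `(k+1)`-st sets of `BNS g'`.  (Indices start at `0`.) -/
theorem bns_proper_contraction_of_refinement (g g' : ℕ → ℕ)
    (hg : ∀ i, 2 ≤ g i) (k : ℕ) (r s : ℕ) (hr : 2 ≤ r) (hs : 2 ≤ s)
    (hk : g k = r * s)
    (h1 : ∀ i < k, g' i = g i) (h2 : g' k = r) (h3 : g' (k + 1) = s)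
    (h4 : ∀ i, k + 2 ≤ i → g' i = g (i - 1)) :
    (∀ i < k, BNS g i = BNS g' i) ∧
    (∀ i, k + 1 ≤ i → BNS g i = BNS g' (i + 1)) ∧
    BNS g k = BNS g' k + BNS g' (k + 1) := by
  have hlow : ∀ i ≤ k, ∏ j ∈ Finset.range i, g j = ∏ j ∈ Finset.range i, g' j := fun i hi =>
    Finset.prod_congr rfl fun j hj => (h1 j ((Finset.mem_range.mp hj).trans_le hi)).symm
  have hhigh : ∀ i, k + 1 ≤ i →
      ∏ j ∈ Finset.range i, g j = ∏ j ∈ Finset.range (i + 1), g' j := by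
    intro i hi
    induction i, hi using Nat.le_induction with
    | base =>
      rw [Finset.prod_range_succ, Finset.prod_range_succ, Finset.prod_range_succ,
        hlow k le_rfl, hk, h2, h3, mul_assoc]
    | succ i hi ih =>
      rw [Finset.prod_range_succ, ih, Finset.prod_range_succ _ (i + 1), h4 (i + 1) (by omega),
        Nat.add_sub_cancel]
  refine ⟨fun i hi => BNS_congr (hlow i hi.le) (h1 i hi).symm, fun i hi =>
    BNS_congr (hhigh i hi) (by rw [h4 (i + 1) (by omega), Nat.add_sub_cancel]), ?_⟩
  simp only [BNS, Finset.prod_range_succ, hlow k le_rfl, hk, h2, h3]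
  exact image_mul_lt_mul _ s (by omega)
end

section
/- Let (g_i)_{i∈ℕ} be a sequence of integers with g_i ≥ 2 for all i, let G be the British number system generated by (g_i), let A = (A_i)_{i∈I} be an additive system, and for each n ∈ ℕ let A_n be the additive system whose sets are G_{k-1}∗[0,g_k) for 1 ≤ k ≤ n together with G_n∗A_i for i ∈ I (the dilation of A by the finite sequence (g_1,…,g_n)). Then lim_{n→∞} A_n = G; that is, a set S belongs to G if and only if S belongs to A_n for all sufficiently large n. -/
/-- Stability of British number systems: let `G` be the British number system of
`(g_i)` and let `A_n` be the dilation of an additive system `A` by the finite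
sequence `(g_1, …, g_n)`, whose sets are `G_{k-1} ∗ [0, g_k)` for `k < n` together
with `G_n ∗ A_i` for `i ∈ I`.  Then `lim_{n → ∞} A_n = G`: a set `S` belongs to
`G` iff `S` belongs to `A_n` for all sufficiently large `n`. -/
theorem limit_of_dilations_eq_bns (g : ℕ → ℕ) (hg : ∀ i, 2 ≤ g i)
    {I : Type*} (A : I → Set ℕ) (hA : IsAdditiveSystem A) (S : Set ℕ) :
    (∃ k : ℕ, S = BNS g k) ↔
      ∃ N : ℕ, ∀ n, N ≤ n →
        ((∃ k < n, S = BNS g k) ∨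
          ∃ i : I, S = (fun x => (∏ j ∈ Finset.range n, g j) * x) '' A i) := by
  constructor
  · rintro ⟨k, hk⟩
    exact ⟨k + 1, fun n hn => Or.inl ⟨k, hn, hk⟩⟩
  · rintro ⟨N, hN⟩
    by_contra hS
    have hdil : ∀ n, N ≤ n →
        ∃ i : I, S = (fun x => (∏ j ∈ Finset.range n, g j) * x) '' A i := fun n hn =>
      (hN n hn).resolve_left fun ⟨k, _, hk⟩ => hS ⟨k, hk⟩
    have hpow : ∀ n, 2 ^ n ≤ ∏ j ∈ Finset.range n, g j := fun n => by
      simpa using Finset.pow_card_le_prod (Finset.range n) g 2 fun j _ => hg j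
    obtain ⟨i, hi⟩ := hdil N le_rfl
    obtain ⟨a, ha, ha0⟩ := (hA.2.2.1 i).exists_ne 0
    have hG : 0 < ∏ j ∈ Finset.range N, g j := (Nat.two_pow_pos N).trans_le (hpow N)
    set y := (∏ j ∈ Finset.range N, g j) * a with hy
    have hy0 : 0 < y := Nat.mul_pos hG (Nat.pos_of_ne_zero ha0)
    have hyS : y ∈ S := hi ▸ Set.mem_image_of_mem _ ha
    obtain ⟨i', hi'⟩ := hdil (max N y) (le_max_left _ _)
    rw [hi'] at hyS
    obtain ⟨b, -, hb⟩ := hyS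
    have hle : ∏ j ∈ Finset.range (max N y), g j ≤ y :=
      Nat.le_of_dvd hy0 (Dvd.intro b hb)
    have hlt : y < 2 ^ max N y :=
      (le_max_right N y).trans_lt Nat.lt_two_pow_self
    exact absurd (hlt.trans_le (hpow _)) hle.not_gt
end

section
/- Let (g_i)_{i∈ℕ} be a sequence of integers with g_i ≥ 2 for all i, and let G be the British number system generated by (g_i). For each n ∈ ℕ, let G_n be the additive system whose sets are G_{k-1}∗[0,g_k) for 1 ≤ k ≤ n together with G_n∗ℕ₀ (the dilation of the trivial additive system (ℕ₀) by the finite sequence (g_1,…,g_n)). Then lim_{n→∞} G_n = G; that is, a set S belongs to G if and only if S belongs to G_n for all sufficiently large n. -/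
/-- The multiples of `g_0 ⋯ g_{n-1}` and of `g_0 ⋯ g_n` form different sets when `g_n ≥ 2`. -/
theorem dilate_univ_ne_dilate_univ_succ (g : ℕ → ℕ) (hg : ∀ i, 2 ≤ g i) (n : ℕ) :
    (fun x => (∏ j ∈ Finset.range n, g j) * x) '' (Set.univ : Set ℕ) ≠
      (fun x => (∏ j ∈ Finset.range (n + 1), g j) * x) '' (Set.univ : Set ℕ) := by
  intro h
  have hpos : 0 < ∏ j ∈ Finset.range n, g j :=
    Finset.prod_pos fun i _ => zero_lt_two.trans_le (hg i)
  obtain ⟨x, -, hx⟩ := h.subset ⟨1, Set.mem_univ 1, rfl⟩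
  simp only [Finset.prod_range_succ, mul_assoc] at hx
  have hone : g n = 1 := Nat.eq_one_of_mul_eq_one_right (Nat.eq_of_mul_eq_mul_left hpos hx)
  have := hg n
  omega

/-- Corollary: if `𝒢_n` is the dilation of the trivial additive system `(ℕ₀)` by
`(g_1, …, g_n)`, whose sets are `G_{k-1} ∗ [0, g_k)` for `k < n` together with
`G_n ∗ ℕ₀`, then `lim_{n → ∞} 𝒢_n = G`, the British number system generated by
`(g_i)`: a set `S` belongs to `G` iff `S` belongs to `𝒢_n` for all sufficiently
large `n`. -/
theorem limit_of_truncations_eq_bns (g : ℕ → ℕ) (hg : ∀ i, 2 ≤ g i)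
    (S : Set ℕ) :
    (∃ k : ℕ, S = BNS g k) ↔
      ∃ N : ℕ, ∀ n, N ≤ n →
        ((∃ k < n, S = BNS g k) ∨
          S = (fun x => (∏ j ∈ Finset.range n, g j) * x) '' (Set.univ : Set ℕ)) := by
  constructor
  · rintro ⟨k, hk⟩
    exact ⟨k + 1, fun n hn => Or.inl ⟨k, hn, hk⟩⟩
  · rintro ⟨N, hN⟩
    rcases hN N le_rfl with ⟨k, -, hk⟩ | hS
    · exact ⟨k, hk⟩
    rcases hN (N + 1) N.le_succ with ⟨k, -, hk⟩ | hS'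
    · exact ⟨k, hk⟩
    exact absurd (hS.symm.trans hS') (dilate_univ_ne_dilate_univ_succ g hg N)
end

section
/- Let (A_i)_{i∈I} be a unique representation system for a set S of integers, with 0 ∈ A_i and |A_i| ≥ 2 for all i ∈ I. If I♭ ⊆ I and S = Σ_{i∈I♭} A_i, then I♭ = I. -/
/-- `(A i)_{i ∈ I}` is a unique representation system for `S`: `S` is the set of
all finitely supported sums `∑ i, a i` with `a i ∈ A i`, and such representations
are unique. -/
def IsUniqueRepSystem {I : Type*} (A : I → Set ℤ) (S : Set ℤ) : Prop :=
  (S = {n | ∃ f : I →₀ ℤ, (∀ i, f i ∈ A i) ∧ f.sum (fun _ x => x) = n}) ∧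
    ∀ f g : I →₀ ℤ, (∀ i, f i ∈ A i) → (∀ i, g i ∈ A i) →
      f.sum (fun _ x => x) = g.sum (fun _ x => x) → f = g
/-- If `(A i)_{i ∈ I}` is a unique representation system for `S` and `S` is already
the sumset of the subfamily `(A i)_{i ∈ I♭}`, then `I♭ = I`. -/
theorem uniqueRepSystem_subfamily_eq {I : Type*} [Nonempty I]
    (A : I → Set ℤ) (S : Set ℤ) (h0 : ∀ i, (0 : ℤ) ∈ A i)
    (h2 : ∀ i, (A i).Nontrivial) (hA : IsUniqueRepSystem A S)
    (Iflat : Set I)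
    (hS : S = {n | ∃ f : I →₀ ℤ, (∀ i, f i ∈ A i) ∧ (∀ i ∉ Iflat, f i = 0) ∧
      f.sum (fun _ x => x) = n}) :
    Iflat = Set.univ := by
  classical
  refine Set.eq_univ_of_forall fun i => ?_
  by_contra hi
  obtain ⟨a, ha, ha0⟩ := (h2 i).exists_ne 0
  have hmem : ∀ j, Finsupp.single i a j ∈ A j := by
    intro j
    rw [Finsupp.single_apply]
    split_ifs with h
    · exact h ▸ ha
    · exact h0 j
  have haS : (Finsupp.single i a).sum (fun _ x => x) ∈ S := by
    rw [hA.1]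
    exact ⟨_, hmem, rfl⟩
  rw [hS] at haS
  obtain ⟨f, hf, hf0, hsum⟩ := haS
  have hfi := hf0 i hi
  rw [hA.2 f _ hf hmem hsum, Finsupp.single_eq_same] at hfi
  exact ha0 hfi
end

section
/- For every integer n ≥ 2, the n-element set {0, 1, 2, 2², …, 2^{n−2}} is indecomposable. -/
/-- A set of nonnegative integers that contains `0` and `1` is indecomposable if it has no two
consecutive elements other than possibly `0, 1` and `1, 2`. -/
theorem not_decomposableSet_of_add_one_mem {A : Set ℤ} (h0 : 0 ∈ A) (h1 : 1 ∈ A)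
    (hnonneg : ∀ x ∈ A, 0 ≤ x) (hsucc : ∀ x ∈ A, x + 1 ∈ A → x = 0 ∨ x = 1) :
    ¬ DecomposableSet A := by
  rintro ⟨B, C, hB, hC, rfl, huniq⟩
  have hmem : ∀ b ∈ B, ∀ c ∈ C, b + c ∈ {n | ∃ b ∈ B, ∃ c ∈ C, n = b + c} :=
    fun b hb c hc => ⟨b, hb, c, hc, rfl⟩
  obtain ⟨b₀, hb₀, c₀, hc₀, h0⟩ := h0
  obtain ⟨b₁, hb₁, c₁, hc₁, h1⟩ := h1
  have hb := hnonneg _ (hmem b₁ hb₁ c₀ hc₀)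
  have hc := hnonneg _ (hmem b₀ hb₀ c₁ hc₁)
  have hcases : (b₁ = b₀ ∧ c₁ = c₀ + 1) ∨ (c₁ = c₀ ∧ b₁ = b₀ + 1) := by omega
  rcases hcases with ⟨rfl, rfl⟩ | ⟨rfl, rfl⟩
  · obtain ⟨b, hbB, hne⟩ := hB.exists_ne b₁
    have hstep := hmem b hbB _ hc₁
    rw [← add_assoc] at hstep
    rcases hsucc _ (hmem b hbB c₀ hc₀) hstep with h | h
    · omega
    · exact hne (huniq b hbB c₀ hc₀ b₁ hb₁ _ hc₁ (by omega)).1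
  · obtain ⟨c, hcC, hne⟩ := hC.exists_ne c₁
    have hstep := hmem _ hb₁ c hcC
    rw [add_right_comm] at hstep
    rcases hsucc _ (hmem b₀ hb₀ c hcC) hstep with h | h
    · omega
    · exact hne (huniq b₀ hb₀ c hcC _ hb₁ c₁ hc₁ (by omega)).2

/-- For every `n ≥ 2`, the `n`-element set `{0, 1, 2, 2², …, 2^{n-2}}` is
indecomposable. -/
theorem powersOfTwo_set_indecomposable (n : ℕ) (hn : 2 ≤ n) :
    ¬ DecomposableSet
      ({0, 1} ∪ (fun k : ℕ => (2 : ℤ) ^ k) '' {k | 1 ≤ k ∧ k ≤ n - 2}) := by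
  apply not_decomposableSet_of_add_one_mem
  · simp
  · simp
  · rintro x ((rfl | rfl) | ⟨k, -, rfl⟩) <;> positivity
  · rintro x ((rfl | rfl) | ⟨k, ⟨hk, -⟩, rfl⟩) hx
    · exact Or.inl rfl
    · exact Or.inr rfl
    · have hpos : (0 : ℤ) < 2 ^ k := by positivity
      have hdvd : (2 : ℤ) ∣ 2 ^ k := dvd_pow_self 2 (by omega)
      rcases hx with (hx | hx) | ⟨j, ⟨hj, -⟩, hx⟩
      · dsimp only at hx
        omega
      · simp only [Set.mem_singleton_iff] at hx
        omega
      · have hdvd' : (2 : ℤ) ∣ 2 ^ j := dvd_pow_self 2 (by omega)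
        dsimp only at hx
        omega
end

section
/- Let n ≥ 2 be an integer. The interval [0,n) has a unique decomposition — i.e., there is exactly one unordered pair {B, C} of sets of integers with |B| ≥ 2, |C| ≥ 2, and [0,n) = B ⊕ C — if and only if n is the square of a prime number. -/
open Polynomial in
/-- The generating polynomial of the part of a set of integers lying in `[0, n)`. -/
noncomputable def setPoly (n : ℕ) (B : Set ℤ) : ℤ[X] :=
  open Classical in ∑ k ∈ (Finset.range n).filter (fun k : ℕ => (k : ℤ) ∈ B), X ^ k

section SetPoly

open Polynomial

variable {n : ℕ} {B C : Set ℤ}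

lemma setPoly_coeff (n : ℕ) (B : Set ℤ) (k : ℕ) [Decidable (k < n ∧ (k : ℤ) ∈ B)] :
    (setPoly n B).coeff k = if k < n ∧ (k : ℤ) ∈ B then 1 else 0 := by
  classical
  simp [setPoly, coeff_X_pow]

lemma eq_of_setPoly_eq (hB : B ⊆ Set.Ico 0 (n : ℤ)) (hC : C ⊆ Set.Ico 0 (n : ℤ))
    (h : setPoly n B = setPoly n C) : B = C := by
  classical
  have key (k : ℕ) : (k < n ∧ (k : ℤ) ∈ B) ↔ (k < n ∧ (k : ℤ) ∈ C) := by
    have hk := congrArg (fun f => f.coeff k) h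
    simp only [setPoly_coeff] at hk
    split_ifs at hk <;> simp_all
  ext x
  constructor
  · intro hx
    obtain ⟨h0, h1⟩ := hB hx
    lift x to ℕ using h0
    exact ((key x).1 ⟨by exact_mod_cast h1, hx⟩).2
  · intro hx
    obtain ⟨h0, h1⟩ := hC hx
    lift x to ℕ using h0
    exact ((key x).2 ⟨by exact_mod_cast h1, hx⟩).2

lemma setPoly_coeff_zero (hn : 0 < n) (h0 : (0 : ℤ) ∈ B) : (setPoly n B).coeff 0 = 1 := by
  classical
  rw [setPoly_coeff, if_pos ⟨hn, by simpa using h0⟩]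

lemma not_isUnit_setPoly (hB : B ⊆ Set.Ico 0 (n : ℤ)) (hB2 : B.Nontrivial) :
    ¬ IsUnit (setPoly n B) := by
  classical
  intro hu
  obtain ⟨x, hx, hx0⟩ := hB2.exists_ne 0
  obtain ⟨h0, h1⟩ := hB hx
  lift x to ℕ using h0
  have hc : (setPoly n B).coeff x = 1 := by
    rw [setPoly_coeff, if_pos ⟨by exact_mod_cast h1, hx⟩]
  rw [eq_C_of_degree_eq_zero (degree_eq_zero_of_isUnit hu), coeff_C,
    if_neg (by exact_mod_cast hx0)] at hc
  exact zero_ne_one hc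

lemma UniqueSumset.symm {A : Set ℤ} (h : UniqueSumset B C A) : UniqueSumset C B A := by
  refine ⟨?_, fun b hb c hc b' hb' c' hc' e => ?_⟩
  · rw [h.1]
    ext x
    constructor
    · rintro ⟨b, hb, c, hc, rfl⟩
      exact ⟨c, hc, b, hb, add_comm _ _⟩
    · rintro ⟨b, hb, c, hc, rfl⟩
      exact ⟨c, hc, b, hb, add_comm _ _⟩
  · exact (h.2 c hc b hb c' hc' b' hb' (by linarith)).symm

lemma UniqueSumset.subset_left {A : Set ℤ} (h : UniqueSumset B C A) (h0 : 0 ∈ C) : B ⊆ A := by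
  intro b hb
  rw [h.1]
  exact ⟨b, hb, 0, h0, (add_zero b).symm⟩

lemma setPoly_mul_setPoly (hB : 0 ∈ B) (hC : 0 ∈ C)
    (h : UniqueSumset B C (Set.Ico 0 (n : ℤ))) :
    setPoly n B * setPoly n C = ∑ k ∈ Finset.range n, X ^ k := by
  classical
  have hBs := h.subset_left hC
  have hCs := h.symm.subset_left hB
  rw [setPoly, setPoly, Finset.sum_mul_sum, ← Finset.sum_product']
  refine Finset.sum_bij (fun x _ => x.1 + x.2) ?_ ?_ ?_ ?_
  · rintro ⟨i, j⟩ hx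
    simp only [Finset.mem_product, Finset.mem_filter, Finset.mem_range] at hx ⊢
    have : ((i : ℤ) + j) ∈ Set.Ico 0 (n : ℤ) := by
      rw [h.1]
      exact ⟨i, hx.1.2, j, hx.2.2, rfl⟩
    exact_mod_cast this.2
  · rintro ⟨i, j⟩ hx ⟨i', j'⟩ hy e
    simp only [Finset.mem_product, Finset.mem_filter] at hx hy
    have := h.2 i hx.1.2 j hx.2.2 i' hy.1.2 j' hy.2.2 (by exact_mod_cast e)
    simpa using this
  · intro k hk
    have hk' : (k : ℤ) ∈ Set.Ico 0 (n : ℤ) :=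
      ⟨by positivity, by exact_mod_cast Finset.mem_range.1 hk⟩
    rw [h.1] at hk'
    obtain ⟨b, hb, c, hc, e⟩ := hk'
    obtain ⟨hb0, hb1⟩ := hBs hb
    obtain ⟨hc0, hc1⟩ := hCs hc
    lift b to ℕ using hb0
    lift c to ℕ using hc0
    refine ⟨(b, c), ?_, by exact_mod_cast e.symm⟩
    simp only [Finset.mem_product, Finset.mem_filter, Finset.mem_range]
    exact ⟨⟨by exact_mod_cast hb1, hb⟩, by exact_mod_cast hc1, hc⟩
  · rintro ⟨i, j⟩ _
    exact (pow_add X i j).symm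

lemma not_prime_of_uniqueSumset (hB : 0 ∈ B) (hC : 0 ∈ C) (hB2 : B.Nontrivial)
    (hC2 : C.Nontrivial) (h : UniqueSumset B C (Set.Ico 0 (n : ℤ))) : ¬ n.Prime := by
  intro hp
  have := Fact.mk hp
  have hirr := cyclotomic.irreducible hp.pos
  rw [cyclotomic_prime, ← setPoly_mul_setPoly hB hC h] at hirr
  exact (hirr.isUnit_or_isUnit rfl).elim (not_isUnit_setPoly (h.subset_left hC) hB2)
    (not_isUnit_setPoly (h.symm.subset_left hB) hC2)

lemma eq_of_mul_eq_mul_of_irreducible {f g a b : ℤ[X]} (ha : Irreducible a)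
    (hb : Irreducible b) (hf : ¬ IsUnit f) (hg : ¬ IsUnit g) (hf0 : f.coeff 0 = 1)
    (hg0 : g.coeff 0 = 1) (ha0 : a.coeff 0 = 1) (h : f * g = a * b) : (f = a ∧ g = b) ∨ (f = b ∧ g = a) := by
  have of_dvd {f g : ℤ[X]} (hg : ¬ IsUnit g) (hf0 : f.coeff 0 = 1) (h : f * g = a * b)
      (hd : a ∣ f) : f = a ∧ g = b := by
    obtain ⟨u, rfl⟩ := hd
    have hub : b = u * g := mul_left_cancel₀ ha.ne_zero (by rw [← h, mul_assoc])
    have hu : IsUnit u := (hb.isUnit_or_isUnit hub).resolve_right hg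
    have hu0 : u.coeff 0 = 1 := by simpa [mul_coeff_zero, ha0] using hf0
    have hu1 : u = 1 := by
      rw [eq_C_of_degree_eq_zero (degree_eq_zero_of_isUnit hu), hu0, map_one]
    simp [hu1, hub]
  have hdvd : a ∣ f ∨ a ∣ g := ha.prime.dvd_or_dvd (h ▸ dvd_mul_right a b)
  rcases hdvd with hd | hd
  · exact Or.inl (of_dvd hg hf0 h hd)
  · exact Or.inr (of_dvd hf hg0 (by rw [mul_comm, h]) hd).symm

lemma geom_sum_prime_sq {p : ℕ} (hp : p.Prime) :
    ∑ k ∈ Finset.range (p ^ 2), (X : ℤ[X]) ^ k = cyclotomic p ℤ * cyclotomic (p ^ 2) ℤ := by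
  rw [← prod_cyclotomic_eq_geom_sum (pow_pos hp.pos 2)]
  have hdiv : (p ^ 2).divisors.erase 1 = {p, p ^ 2} := by
    have h1 := hp.one_lt
    have h2 : 1 < p ^ 2 := Nat.one_lt_pow two_ne_zero h1
    ext d
    simp only [Finset.mem_erase, Nat.mem_divisors_prime_pow hp, Finset.mem_insert,
      Finset.mem_singleton]
    constructor
    · rintro ⟨hd, j, hj, rfl⟩
      interval_cases j <;> simp_all
    · rintro (rfl | rfl)
      · exact ⟨h1.ne', 1, by norm_num, by simp⟩
      · exact ⟨h2.ne', 2, le_rfl, rfl⟩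
  rw [hdiv, Finset.prod_pair]
  exact (lt_self_pow₀ hp.one_lt one_lt_two).ne

lemma setPoly_eq_cyclotomic {p : ℕ} (hp : p.Prime) (hB : 0 ∈ B) (hC : 0 ∈ C)
    (hB2 : B.Nontrivial) (hC2 : C.Nontrivial)
    (h : UniqueSumset B C (Set.Ico 0 ((p ^ 2 : ℕ) : ℤ))) :
    (setPoly (p ^ 2) B = cyclotomic p ℤ ∧ setPoly (p ^ 2) C = cyclotomic (p ^ 2) ℤ) ∨
      (setPoly (p ^ 2) B = cyclotomic (p ^ 2) ℤ ∧ setPoly (p ^ 2) C = cyclotomic p ℤ) :=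
  have hpos : 0 < p ^ 2 := pow_pos hp.pos 2
  eq_of_mul_eq_mul_of_irreducible (cyclotomic.irreducible hp.pos) (cyclotomic.irreducible hpos)
    (not_isUnit_setPoly (h.subset_left hC) hB2) (not_isUnit_setPoly (h.symm.subset_left hB) hC2)
    (setPoly_coeff_zero hpos hB) (setPoly_coeff_zero hpos hC)
    (cyclotomic_coeff_zero ℤ hp.one_lt) (by rw [setPoly_mul_setPoly hB hC h, geom_sum_prime_sq hp])

end SetPoly

lemma uniqueSumset_Ico_image_mul {d : ℤ} (hd : 0 < d) (e : ℤ) :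
    UniqueSumset (Set.Ico 0 d) ((d * ·) '' Set.Ico 0 e) (Set.Ico 0 (d * e)) := by
  constructor
  · ext x
    constructor
    · rintro ⟨h0, h1⟩
      exact ⟨x % d, ⟨Int.emod_nonneg x hd.ne', Int.emod_lt_of_pos x hd⟩, d * (x / d),
        ⟨x / d, ⟨Int.ediv_nonneg h0 hd.le, Int.ediv_lt_of_lt_mul hd (by linarith)⟩, rfl⟩,
        (Int.emod_add_mul_ediv x d).symm⟩
    · rintro ⟨b, ⟨hb0, hb1⟩, _, ⟨k, ⟨hk0, hk1⟩, rfl⟩, rfl⟩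
      exact ⟨by positivity, by dsimp only; nlinarith⟩
  · rintro b ⟨hb0, hb1⟩ _ ⟨k, -, rfl⟩ b' ⟨hb0', hb1'⟩ _ ⟨k', -, rfl⟩ e
    have hmod := congrArg (· % d) e
    simp only [Int.add_mul_emod_self_left, Int.emod_eq_of_lt hb0 hb1,
      Int.emod_eq_of_lt hb0' hb1'] at hmod
    exact ⟨hmod, by linarith⟩

lemma Ico_zero_nontrivial {d : ℤ} (hd : 1 < d) : (Set.Ico 0 d).Nontrivial :=
  ⟨0, ⟨le_rfl, by linarith⟩, 1, ⟨zero_le_one, hd⟩, zero_ne_one⟩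

lemma Ico_zero_ne_image_mul {d e f : ℤ} (hd : 1 < d) (he : 1 < e) :
    Set.Ico 0 d ≠ (e * ·) '' Set.Ico 0 f := by
  intro h
  have h1 : (1 : ℤ) ∈ Set.Ico 0 d := ⟨zero_le_one, hd⟩
  rw [h] at h1
  obtain ⟨k, -, hk⟩ := h1
  have := Int.eq_one_or_neg_one_of_mul_eq_one (u := e) (v := k) hk
  omega

lemma eq_of_Ico_zero_eq {d e : ℤ} (hd : 0 < d) (he : 0 < e) (h : Set.Ico 0 d = Set.Ico 0 e) :
    d = e := by
  have h1 : d - 1 ∈ Set.Ico 0 e := h ▸ ⟨by linarith, by linarith⟩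
  have h2 : e - 1 ∈ Set.Ico 0 d := h ▸ ⟨by linarith, by linarith⟩
  linarith [Int.sub_one_lt_iff.1 h1.2, Int.sub_one_lt_iff.1 h2.2]


/-- The interval `[0, n)` has a unique decomposition — exactly one unordered pair
`{B, C}` of sets of integers (normalized so that `0 ∈ B ∩ C`, which is automatic)
with `|B| ≥ 2`, `|C| ≥ 2` and `[0, n) = B ⊕ C` — if and only if `n` is the square
of a prime. -/
theorem interval_unique_decomposition_iff_prime_sq (n : ℕ) (hn : 2 ≤ n) :
    (∃ B C : Set ℤ, 0 ∈ B ∧ 0 ∈ C ∧ B.Nontrivial ∧ C.Nontrivial ∧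
        UniqueSumset B C (Set.Ico 0 (n : ℤ)) ∧
        ∀ B' C' : Set ℤ, 0 ∈ B' → 0 ∈ C' → B'.Nontrivial → C'.Nontrivial →
          UniqueSumset B' C' (Set.Ico 0 (n : ℤ)) →
          (B = B' ∧ C = C') ∨ (B = C' ∧ C = B')) ↔
      ∃ p : ℕ, p.Prime ∧ n = p ^ 2 := by
  constructor
  · rintro ⟨B, C, hB, hC, hB2, hC2, h, huniq⟩
    have hnp := not_prime_of_uniqueSumset hB hC hB2 hC2 h
    have hp := Nat.minFac_prime (n := n) (by omega)
    obtain ⟨e, he⟩ := Nat.minFac_dvd n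
    set p := n.minFac
    have he1 : 1 < e := by
      by_contra! hle
      interval_cases e
      · omega
      · exact hnp (by rw [he, mul_one]; exact hp)
    have huniq' {d f : ℕ} (hd : 1 < d) (hf : 1 < f) (hdf : n = d * f) :
        (B = Set.Ico 0 (d : ℤ) ∧ C = ((d : ℤ) * ·) '' Set.Ico 0 (f : ℤ)) ∨
          (B = ((d : ℤ) * ·) '' Set.Ico 0 (f : ℤ) ∧ C = Set.Ico 0 (d : ℤ)) := by
      have hd' : (1 : ℤ) < d := by exact_mod_cast hd
      have hf' : (1 : ℤ) < f := by exact_mod_cast hf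
      refine huniq _ _ ⟨le_rfl, by linarith⟩ ⟨0, ⟨le_rfl, by linarith⟩, mul_zero _⟩
        (Ico_zero_nontrivial hd')
        ((Ico_zero_nontrivial hf').image (mul_right_injective₀ (by linarith))) ?_
      rw [hdf, Nat.cast_mul]
      exact uniqueSumset_Ico_image_mul (by linarith) _
    have hp' : (1 : ℤ) < p := by exact_mod_cast hp.one_lt
    have he' : (1 : ℤ) < e := by exact_mod_cast he1
    have hIco : Set.Ico 0 (p : ℤ) = Set.Ico 0 (e : ℤ) := by
      rcases huniq' hp.one_lt he1 he with ⟨h1, h2⟩ | ⟨h1, h2⟩ <;>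
        rcases huniq' he1 hp.one_lt (he.trans (mul_comm _ _)) with ⟨h3, h4⟩ | ⟨h3, h4⟩
      · exact h1.symm.trans h3
      · exact absurd (h1.symm.trans h3) (Ico_zero_ne_image_mul hp' he')
      · exact absurd (h2.symm.trans h4) (Ico_zero_ne_image_mul hp' he')
      · exact h2.symm.trans h4
    have hpe : p = e := by
      exact_mod_cast eq_of_Ico_zero_eq (by linarith) (by linarith) hIco
    exact ⟨p, hp, by rw [sq]; exact he.trans (by rw [← hpe])⟩
  · rintro ⟨p, hp, rfl⟩
    have hp' : (1 : ℤ) < p := by exact_mod_cast hp.one_lt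
    have h : UniqueSumset (Set.Ico 0 (p : ℤ)) (((p : ℤ) * ·) '' Set.Ico 0 (p : ℤ))
        (Set.Ico 0 ((p ^ 2 : ℕ) : ℤ)) := by
      rw [sq, Nat.cast_mul]
      exact uniqueSumset_Ico_image_mul (by linarith) _
    have hB : (0 : ℤ) ∈ Set.Ico 0 (p : ℤ) := ⟨le_rfl, by linarith⟩
    have hC : (0 : ℤ) ∈ ((p : ℤ) * ·) '' Set.Ico 0 (p : ℤ) := ⟨0, hB, mul_zero _⟩
    have hB2 := Ico_zero_nontrivial hp'
    have hC2 : (((p : ℤ) * ·) '' Set.Ico 0 (p : ℤ)).Nontrivial :=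
      hB2.image (mul_right_injective₀ (by linarith))
    refine ⟨_, _, hB, hC, hB2, hC2, h, fun B' C' hB' hC' hB2' hC2' h' => ?_⟩
    have hBs := h.subset_left hC
    have hCs := h.symm.subset_left hB
    have hBs' := h'.subset_left hC'
    have hCs' := h'.symm.subset_left hB'
    rcases setPoly_eq_cyclotomic hp hB hC hB2 hC2 h with ⟨h1, h2⟩ | ⟨h1, h2⟩ <;>
      rcases setPoly_eq_cyclotomic hp hB' hC' hB2' hC2' h' with ⟨h3, h4⟩ | ⟨h3, h4⟩
    · exact Or.inl ⟨eq_of_setPoly_eq hBs hBs' (h1.trans h3.symm),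
        eq_of_setPoly_eq hCs hCs' (h2.trans h4.symm)⟩
    · exact Or.inr ⟨eq_of_setPoly_eq hBs hCs' (h1.trans h4.symm),
        eq_of_setPoly_eq hCs hBs' (h2.trans h3.symm)⟩
    · exact Or.inr ⟨eq_of_setPoly_eq hBs hCs' (h1.trans h4.symm),
        eq_of_setPoly_eq hCs hBs' (h2.trans h3.symm)⟩
    · exact Or.inl ⟨eq_of_setPoly_eq hBs hBs' (h1.trans h3.symm),
        eq_of_setPoly_eq hCs hCs' (h2.trans h4.symm)⟩
end
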